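/- arXiv:2509.06294 — 11 statements merged into one kernel-verified Lean document; each statement's English description precedes it below -/
import Mathlib

section
/- For every integer n ≥ 2 and every field F, the slice rank of the determinant polynomial det_n equals n. That is: (a) there exist linear forms α_1,...,α_n and homogeneous polynomials g_1,...,g_n of degree n−1 with det_n = Σ_{i=1}^n α_i g_i (e.g., the Laplace expansion along the first row); and (b) for every r, if det_n = Σ_{i=1}^r α_i g_i with each α_i homogeneous of degree 1 and each g_i homogeneous of degree n−1, then r ≥ n. -/
open MvPolynomial

/-- The determinant polynomial `det_n`: the determinant of the `n × n` matrix of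
variables `X (i, j)`, as a multivariate polynomial over `F`. -/
noncomputable def detPoly (F : Type*) [Field F] (n : ℕ) : MvPolynomial (Fin n × Fin n) F :=
  (Matrix.of fun i j => (X (i, j) : MvPolynomial (Fin n × Fin n) F)).det

/-- A slice rank decomposition of `det_n` of length `r`: linear forms `α i` and
homogeneous degree-`(n-1)` polynomials `g i` with `det_n = Σ i, α i * g i`. -/
def IsSliceDecompOfDet (F : Type*) [Field F] (n r : ℕ)
    (α g : Fin r → MvPolynomial (Fin n × Fin n) F) : Prop :=
  (∀ i, (α i).IsHomogeneous 1) ∧ (∀ i, (g i).IsHomogeneous (n - 1)) ∧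
    detPoly F n = ∑ i, α i * g i

section LinearSubspaces

open Module LinearMap

variable {F V U : Type*} [Field F] [AddCommGroup V] [Module F V] [AddCommGroup U] [Module F U]

/-- A subspace of linear maps containing all rank-one maps is everything. -/
lemma LinearMap.eq_top_of_forall_smulRight_mem [FiniteDimensional F V]
    (W : Submodule F (V →ₗ[F] U)) (h : ∀ (φ : Dual F V) (u : U), φ.smulRight u ∈ W) :
    W = ⊤ := by
  rw [eq_top_iff]
  intro f _
  let b := Module.finBasis F V
  have hf : f = ∑ i, (b.coord i).smulRight (f (b i)) := by
    refine b.ext fun j => ?_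
    simp [LinearMap.sum_apply, Finsupp.single_apply, ite_smul]
  rw [hf]
  exact W.sum_mem fun i _ => h _ _

/-- If the map induced by `f` from `ker φ` to the quotient by the span of `u ≠ 0` is injective,
then `f` or its rank-one perturbation `f + φ ⊗ u` is injective. -/
lemma LinearMap.injective_or_injective_add_smulRight (f : V →ₗ[F] U) {φ : Dual F V} {u : U}
    (hu : u ≠ 0)
    (hf : ∀ x, φ x = 0 → f x ∈ Submodule.span F {u} → x = 0) :
    Function.Injective f ∨ Function.Injective (f + φ.smulRight u) := by
  by_cases hinj : Function.Injective f
  · exact Or.inl hinj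
  right
  obtain ⟨x, hx, hx0⟩ : ∃ x, f x = 0 ∧ x ≠ 0 := by
    simpa [injective_iff_map_eq_zero] using hinj
  have hφx : φ x ≠ 0 := fun h => hx0 (hf x h (by simp [hx]))
  rw [injective_iff_map_eq_zero]
  intro y hy
  simp only [add_apply, smulRight_apply] at hy
  have hker : y - (φ y / φ x) • x = 0 := by
    refine hf _ (by simp [hφx]) ?_
    rw [map_sub, map_smul, hx, smul_zero, sub_zero, eq_neg_of_add_eq_zero_left hy]
    exact Submodule.neg_mem _ (Submodule.smul_mem _ _ (Submodule.mem_span_singleton_self u))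
  have hy' : y = (φ y / φ x) • x := sub_eq_zero.mp hker
  have hfy : f y = 0 := by rw [hy', map_smul, hx, smul_zero]
  rw [hfy, zero_add, smul_eq_zero_iff_left hu] at hy
  rw [hy', hy, zero_div, zero_smul]

/-- Restricting linear maps to a subspace of the source and reducing them modulo a subspace of the
target, as a linear map. -/
def LinearMap.compress (K : Submodule F V) (L : Submodule F U) :
    (V →ₗ[F] U) →ₗ[F] (K →ₗ[F] U ⧸ L) where
  toFun f := L.mkQ ∘ₗ f ∘ₗ K.subtype
  map_add' f g := by ext; simp
  map_smul' c f := by ext; simp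

lemma LinearMap.compress_surjective (K : Submodule F V) (L : Submodule F U) :
    Function.Surjective (LinearMap.compress K L) := by
  intro g
  obtain ⟨p, hp⟩ := K.subtype.exists_leftInverse_of_injective K.ker_subtype
  obtain ⟨s, hs⟩ := L.mkQ.exists_rightInverse_of_surjective L.range_mkQ
  refine ⟨s ∘ₗ g ∘ₗ p, ?_⟩
  ext x
  have h1 : p x = x := LinearMap.congr_fun hp x
  have h2 : L.mkQ (s (g x)) = g x := LinearMap.congr_fun hs (g x)
  simpa [LinearMap.compress, h1] using h2

/-- **Dieudonné's theorem** on linear spaces of singular maps: a space of linear maps between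
`n`-dimensional spaces of codimension less than `n` contains an injective map. -/
theorem LinearMap.exists_mem_injective_of_lt_finrank_add (n : ℕ) :
    ∀ {V U : Type*} [AddCommGroup V] [Module F V] [AddCommGroup U] [Module F U]
      [FiniteDimensional F V] [FiniteDimensional F U], finrank F V = n → finrank F U = n →
      ∀ W : Submodule F (V →ₗ[F] U), n * n < finrank F W + n →
        ∃ f ∈ W, Function.Injective f := by
  induction n with
  | zero =>
    intro V U _ _ _ _ _ _ hV hU W hW
    have := W.finrank_le
    rw [finrank_linearMap, hV, hU] at this
    omega
  | succ m ih =>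
    intro V U _ _ _ _ _ _ hV hU W hW
    by_cases hall : ∀ (φ : Dual F V) (u : U), φ.smulRight u ∈ W
    · rw [eq_top_of_forall_smulRight_mem W hall]
      exact ⟨(LinearEquiv.ofFinrankEq V U (hV.trans hU.symm)).toLinearMap, trivial,
        LinearEquiv.injective _⟩
    push Not at hall
    obtain ⟨ψ, u, hψ⟩ := hall
    have hu : u ≠ 0 := by
      rintro rfl
      exact hψ (by convert W.zero_mem; ext; simp)
    obtain ⟨φ, hφ0, hφW⟩ : ∃ φ : Dual F V, φ ≠ 0 ∧ φ.smulRight u ∈ W := by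
      let S : Dual F V →ₗ[F] (V →ₗ[F] U) := LinearMap.smulRightₗ.flip u
      have hS : Function.Injective S := by
        rw [injective_iff_map_eq_zero]
        intro φ hφ
        ext x
        have := LinearMap.congr_fun hφ x
        simpa [S, hu] using this
      have hr : finrank F (LinearMap.range S) = m + 1 := by
        rw [LinearMap.finrank_range_of_inj hS, Subspace.dual_finrank_eq, hV]
      have hsum := Submodule.finrank_sup_add_finrank_inf_eq (LinearMap.range S) W
      have hle := (LinearMap.range S ⊔ W).finrank_le
      rw [finrank_linearMap, hV, hU] at hle
      have hpos : LinearMap.range S ⊓ W ≠ ⊥ := by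
        rw [← Submodule.one_le_finrank_iff]
        omega
      obtain ⟨f, ⟨⟨φ, rfl⟩, hf⟩, hf0⟩ := Submodule.exists_mem_ne_zero_of_ne_bot hpos
      exact ⟨φ, fun h => hf0 (by rw [h, map_zero]), hf⟩
    let L := Submodule.span F {u}
    let π := LinearMap.compress (LinearMap.ker φ) L
    have hK : finrank F (LinearMap.ker φ) = m := by
      have := Dual.finrank_ker_add_one_of_ne_zero hφ0
      omega
    have hL : finrank F (U ⧸ L) = m := by
      have := L.finrank_quotient_add_finrank
      rw [finrank_span_singleton hu] at this
      omega
    have hkerπ : finrank F (LinearMap.ker π) + m * m = (m + 1) * (m + 1) := by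
      have := π.finrank_range_add_finrank_ker
      rw [LinearMap.range_eq_top.mpr (LinearMap.compress_surjective _ _), finrank_top,
        finrank_linearMap, finrank_linearMap, hK, hL, hV, hU] at this
      omega
    have hlt : LinearMap.ker π ⊓ W < LinearMap.ker π := by
      refine lt_of_le_of_ne inf_le_left fun h => hψ ?_
      have hmem : ψ.smulRight u ∈ LinearMap.ker π := by
        rw [LinearMap.mem_ker]
        ext x
        simp [π, L, LinearMap.compress]
      rw [← h] at hmem
      exact hmem.2
    have hlt' := Submodule.finrank_lt_finrank_of_lt hlt
    have hmap : finrank F (W.map π) + finrank F (LinearMap.ker π ⊓ W : Submodule F _) =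
        finrank F W := by
      have := (π.domRestrict W).finrank_range_add_finrank_ker
      rwa [LinearMap.range_domRestrict, LinearMap.ker_domRestrict,
        ← Submodule.finrank_map_subtype_eq, Submodule.map_comap_subtype, inf_comm] at this
    obtain ⟨g, ⟨f, hf, rfl⟩, hg⟩ := ih hK hL (W.map π) (by nlinarith)
    have hf' : ∀ x, φ x = 0 → f x ∈ Submodule.span F {u} → x = 0 := by
      intro x hx hfx
      have hz : (⟨x, hx⟩ : LinearMap.ker φ) = 0 := by
        apply (injective_iff_map_eq_zero _).mp hg
        simpa [π, L, LinearMap.compress] using hfx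
      exact congrArg Subtype.val hz
    rcases injective_or_injective_add_smulRight f hu hf' with h | h
    · exact ⟨f, hf, h⟩
    · exact ⟨_, W.add_mem hf hφW, h⟩

end LinearSubspaces

/-- Evaluation of a linear form is a linear functional. -/
lemma MvPolynomial.IsHomogeneous.exists_dual_eval {F σ : Type*} [Field F]
    {p : MvPolynomial σ F} (hp : p.IsHomogeneous 1) :
    ∃ l : Module.Dual F (σ → F), ∀ x, l x = eval x p := by
  rw [← mem_homogeneousSubmodule, homogeneousSubmodule_one_eq_span_X] at hp
  induction hp using Submodule.span_induction with
  | mem p hp =>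
    obtain ⟨i, rfl⟩ := hp
    exact ⟨LinearMap.proj i, fun x => by simp⟩
  | zero => exact ⟨0, fun x => by simp⟩
  | add p q _ _ hp hq =>
    obtain ⟨l, hl⟩ := hp
    obtain ⟨k, hk⟩ := hq
    exact ⟨l + k, fun x => by simp [hl, hk]⟩
  | smul c p _ hp =>
    obtain ⟨l, hl⟩ := hp
    exact ⟨c • l, fun x => by simp [hl, smul_eval]⟩

lemma Matrix.isHomogeneous_det {F σ ι : Type*} [Field F] [Fintype ι] [DecidableEq ι]
    (M : Matrix ι ι (MvPolynomial σ F)) (hM : ∀ i j, (M i j).IsHomogeneous 1) :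
    M.det.IsHomogeneous (Fintype.card ι) := by
  rw [Matrix.det_apply']
  refine IsHomogeneous.sum _ _ _ fun τ _ => ?_
  have hprod : (∏ i, M (τ i) i).IsHomogeneous (Fintype.card ι) := by
    simpa using IsHomogeneous.prod Finset.univ (fun i => M (τ i) i) (fun _ => 1)
      fun i _ => hM _ _
  rcases Int.units_eq_one_or (Equiv.Perm.sign τ) with h | h
  · simpa [h] using hprod
  · simpa [h] using hprod.neg

lemma eval_detPoly {F : Type*} [Field F] {n : ℕ} (A : Matrix (Fin n) (Fin n) F) :
    eval (fun p : Fin n × Fin n => A p.1 p.2) (detPoly F n) = A.det := by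
  rw [detPoly, RingHom.map_det]
  congr 1
  ext i j
  simp

lemma exists_isSliceDecompOfDet (F : Type*) [Field F] (m : ℕ) :
    ∃ α g : Fin (m + 1) → MvPolynomial (Fin (m + 1) × Fin (m + 1)) F,
      IsSliceDecompOfDet F (m + 1) (m + 1) α g := by
  let M : Matrix (Fin (m + 1)) (Fin (m + 1)) (MvPolynomial (Fin (m + 1) × Fin (m + 1)) F) :=
    Matrix.of fun i j => X (i, j)
  refine ⟨fun j => X (0, j),
    fun j => (-1) ^ (j : ℕ) * (M.submatrix Fin.succ j.succAbove).det,
    fun j => isHomogeneous_X _ _, fun j => ?_, ?_⟩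
  · have hdet := Matrix.isHomogeneous_det (M.submatrix Fin.succ j.succAbove)
      fun i k => isHomogeneous_X _ _
    rw [Fintype.card_fin] at hdet
    rcases neg_one_pow_eq_or (MvPolynomial (Fin (m + 1) × Fin (m + 1)) F) (j : ℕ) with h | h
    · simpa [h] using hdet
    · simpa [h] using hdet.neg
  · rw [detPoly, Matrix.det_succ_row_zero]
    refine Finset.sum_congr rfl fun j _ => ?_
    simp only [Matrix.of_apply, M]
    ring

lemma IsSliceDecompOfDet.le {F : Type*} [Field F] {n r : ℕ}
    {α g : Fin r → MvPolynomial (Fin n × Fin n) F} (h : IsSliceDecompOfDet F n r α g) :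
    n ≤ r := by
  obtain ⟨hα, -, hdet⟩ := h
  by_contra! hr
  choose l hl using fun i => (hα i).exists_dual_eval
  let entries : ((Fin n → F) →ₗ[F] (Fin n → F)) →ₗ[F] (Fin n × Fin n → F) :=
    LinearMap.pi fun p => LinearMap.proj p.2 ∘ₗ LinearMap.proj p.1 ∘ₗ
      LinearMap.toMatrix'.toLinearMap
  let Λ : ((Fin n → F) →ₗ[F] (Fin n → F)) →ₗ[F] (Fin r → F) :=
    LinearMap.pi fun i => l i ∘ₗ entries
  have hker : n * n < Module.finrank F (LinearMap.ker Λ) + n := by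
    have h1 := Λ.finrank_range_add_finrank_ker
    have h2 := (LinearMap.range Λ).finrank_le
    rw [Module.finrank_linearMap, Module.finrank_fin_fun] at h1
    rw [Module.finrank_fin_fun] at h2
    omega
  obtain ⟨f, hf, hinj⟩ := LinearMap.exists_mem_injective_of_lt_finrank_add n
    (Module.finrank_fin_fun F) (Module.finrank_fin_fun F) (LinearMap.ker Λ) hker
  have hzero : (LinearMap.toMatrix' f).det = 0 := by
    rw [← eval_detPoly, hdet, map_sum]
    refine Finset.sum_eq_zero fun i _ => ?_
    have hi : l i (entries f) = 0 := congrFun (LinearMap.mem_ker.mp hf) i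
    rw [hl] at hi
    rw [map_mul]
    exact mul_eq_zero_of_left hi _
  rw [LinearMap.det_toMatrix'] at hzero
  have hbot := LinearMap.bot_lt_ker_of_det_eq_zero hzero
  rw [LinearMap.ker_eq_bot.mpr hinj] at hbot
  exact lt_irrefl _ hbot

theorem sliceRank_det_eq {F : Type*} [Field F] (n : ℕ) (hn : 2 ≤ n) :
    (∃ α g : Fin n → MvPolynomial (Fin n × Fin n) F, IsSliceDecompOfDet F n n α g) ∧
      ∀ (r : ℕ) (α g : Fin r → MvPolynomial (Fin n × Fin n) F),
        IsSliceDecompOfDet F n r α g → n ≤ r := by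
  refine ⟨?_, fun r α g h => h.le⟩
  obtain ⟨m, rfl⟩ : ∃ m, n = m + 1 := ⟨n - 1, by omega⟩
  exact exists_isSliceDecompOfDet F m
end

section
/- For every n ≥ 2 and every field F, every slice rank decomposition of det_n of length n is equivalent to the Laplace expansion along the first row, i.e., to the decomposition (β, h) with β_j = X_{(1,j)} and h_j = (−1)^{1+j} times the determinant of the (n−1)×(n−1) matrix of variables obtained by deleting row 1 and column j. -/
open MvPolynomial

/-- Substitution of variables by the linear change of variables given by the matrix `A`:
`(substVar A p)(v) = p(A · v)` for every point `v : σ → F`. -/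
noncomputable def substVar {F : Type*} [Field F] {σ : Type*} [Fintype σ]
    (A : Matrix σ σ F) (p : MvPolynomial σ F) : MvPolynomial σ F :=
  aeval (fun s => ∑ t : σ, C (A s t) * X t) p

/-- A slice rank decomposition of a degree-`d` form `f` of length `r`:
linear forms `α i` and homogeneous degree-`(d-1)` forms `g i` with `f = Σ i, α i * g i`. -/
def IsSliceDecomp {F : Type*} [Field F] {σ : Type*} (f : MvPolynomial σ F) (d r : ℕ)
    (α g : Fin r → MvPolynomial σ F) : Prop :=
  (∀ i, (α i).IsHomogeneous 1) ∧ (∀ i, (g i).IsHomogeneous (d - 1)) ∧ f = ∑ i, α i * g i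

/-- One reduction step between slice rank decompositions of `f` (degree `d`, length `r`):
linear reduction, syzygy reduction, or symmetric reduction. -/
inductive SliceStep {F : Type*} [Field F] {σ : Type*} [Fintype σ] [DecidableEq σ]
    (f : MvPolynomial σ F) (d r : ℕ) :
    (Fin r → MvPolynomial σ F) × (Fin r → MvPolynomial σ F) →
      (Fin r → MvPolynomial σ F) × (Fin r → MvPolynomial σ F) → Prop
  | linear (α g β : Fin r → MvPolynomial σ F) (c : Fin r → Fin r → F)
      (hβ : ∀ j, (β j).IsHomogeneous 1)
      (hc : ∀ i, α i = ∑ j, C (c i j) * β j) :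
      SliceStep f d r (β, fun j => ∑ i, C (c i j) * g i) (α, g)
  | syzygy (α g : Fin r → MvPolynomial σ F) (q : Fin r → Fin r → MvPolynomial σ F)
      (hq : ∀ i j, (q i j).IsHomogeneous (d - 2))
      (hdiag : ∀ i, q i i = 0) (hskew : ∀ i j, q i j = - q j i) :
      SliceStep f d r (α, fun i => g i - ∑ j ∈ Finset.univ.erase i, q i j * α j) (α, g)
  | symm (α g : Fin r → MvPolynomial σ F) (A : Matrix σ σ F)
      (hA : substVar A f = f) :
      SliceStep f d r (fun i => substVar A (α i), fun i => substVar A (g i)) (α, g)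

/-- The reduction preorder `≲` on slice rank decompositions: the reflexive-transitive
closure of the reduction steps. -/
def SliceLE {F : Type*} [Field F] {σ : Type*} [Fintype σ] [DecidableEq σ]
    (f : MvPolynomial σ F) (d r : ℕ)
    (p q : (Fin r → MvPolynomial σ F) × (Fin r → MvPolynomial σ F)) : Prop :=
  Relation.ReflTransGen (SliceStep f d r) p q

/-- Two slice rank decompositions are equivalent if each is `≲` the other. -/
def SliceEquiv {F : Type*} [Field F] {σ : Type*} [Fintype σ] [DecidableEq σ]
    (f : MvPolynomial σ F) (d r : ℕ)
    (p q : (Fin r → MvPolynomial σ F) × (Fin r → MvPolynomial σ F)) : Prop :=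
  SliceLE f d r p q ∧ SliceLE f d r q p

/-- The linear forms of the Laplace expansion along the first row: `β j = X (1, j)`. -/
noncomputable def laplaceβ (F : Type*) [Field F] (m : ℕ) (j : Fin (m + 2)) :
    MvPolynomial (Fin (m + 2) × Fin (m + 2)) F :=
  X (0, j)

/-- The cofactors of the Laplace expansion along the first row:
`h j = (−1)^{1+j}` times the determinant of the matrix of variables with
row `1` and column `j` deleted (here `j` is 0-indexed, so the sign is `(−1)^j`). -/
noncomputable def laplaceh (F : Type*) [Field F] (m : ℕ) (j : Fin (m + 2)) :
    MvPolynomial (Fin (m + 2) × Fin (m + 2)) F :=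
  (-1) ^ (j : ℕ) *
    ((Matrix.of fun i k => (X (i, k) : MvPolynomial (Fin (m + 2) × Fin (m + 2)) F)).submatrix
      Fin.succ j.succAbove).det

theorem mem_span_X_of_X_mul_mem {σ R : Type*} [CommRing R] {s : Set σ} {a : σ} (ha : a ∉ s)
    {p : MvPolynomial σ R} (h : X a * p ∈ Ideal.span ((X : σ → MvPolynomial σ R) '' s)) :
    p ∈ Ideal.span ((X : σ → MvPolynomial σ R) '' s) := by
  classical
  rw [mem_ideal_span_X_image] at h ⊢
  intro d hd
  have hd' : Finsupp.single a 1 + d ∈ (X a * p).support := by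
    rw [mem_support_iff, coeff_X_mul]
    exact mem_support_iff.1 hd
  obtain ⟨i, his, hi⟩ := h _ hd'
  refine ⟨i, his, ?_⟩
  have hne : a ≠ i := fun h => ha (h ▸ his)
  simpa [Finsupp.single_apply, hne] using hi

theorem exists_alternating_of_sum_X_mul_eq_zero {σ R : Type*} [CommRing R] :
    ∀ {r : ℕ} {x : Fin r → σ}, Function.Injective x → ∀ {p : Fin r → MvPolynomial σ R},
    ∑ i, X (x i) * p i = 0 →
    ∃ q : Fin r → Fin r → MvPolynomial σ R, (∀ i, q i i = 0) ∧ (∀ i j, q i j = -q j i) ∧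
      ∀ i, p i = ∑ j, q i j * X (x j)
  | 0, _, _, _, _ => ⟨fun _ _ => 0, by simp, by simp, fun i => i.elim0⟩
  | r + 1, x, hx, p, h => by
    rw [Fin.sum_univ_succ] at h
    have hmem : p 0 ∈
        Ideal.span ((X : σ → MvPolynomial σ R) '' Set.range fun i : Fin r => x i.succ) := by
      refine mem_span_X_of_X_mul_mem (a := x 0) ?_ ?_
      · rintro ⟨i, hi⟩
        exact Fin.succ_ne_zero i (hx hi)
      · rw [eq_neg_of_add_eq_zero_left h]
        exact neg_mem (Ideal.sum_mem _ fun i _ =>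
          Ideal.mul_mem_right _ _ (Ideal.subset_span ⟨_, ⟨i, rfl⟩, rfl⟩))
    rw [← Set.range_comp, Ideal.mem_span_range_iff_exists_fun] at hmem
    obtain ⟨a, ha⟩ := hmem
    obtain ⟨q, hq0, hqs, hq⟩ := exists_alternating_of_sum_X_mul_eq_zero
      (x := fun i : Fin r => x i.succ) (fun i j hij => Fin.succ_injective _ (hx hij))
      (p := fun i => p i.succ + a i * X (x 0)) (by
        rw [← h, ← ha, Finset.mul_sum, ← Finset.sum_add_distrib]
        refine Finset.sum_congr rfl fun i _ => ?_
        simp only [Function.comp]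
        ring)
    refine ⟨Fin.cons (Fin.cons 0 a) fun i => Fin.cons (-a i) (q i), ?_, ?_, ?_⟩
    · intro i
      cases i using Fin.cases <;> simp [hq0]
    · intro i j
      cases i using Fin.cases <;> cases j using Fin.cases <;> simp
      exact hqs _ _
    · intro i
      cases i using Fin.cases with
      | zero => simp [Fin.sum_univ_succ, ← ha]
      | succ i =>
        simp [Fin.sum_univ_succ, ← hq]

theorem homogeneousComponent_succ_mul_X {σ R : Type*} [CommRing R] (k : ℕ)
    (q : MvPolynomial σ R) (s : σ) :
    homogeneousComponent (k + 1) (q * X s) = homogeneousComponent k q * X s := by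
  classical
  ext d
  rw [coeff_homogeneousComponent, coeff_mul_X', coeff_mul_X', coeff_homogeneousComponent]
  by_cases hs : s ∈ d.support
  · have hd : d.degree = (d - Finsupp.single s 1).degree + 1 := by
      have h1 : Finsupp.single s 1 ≤ d := by
        rw [Finsupp.single_le_iff]
        exact Nat.one_le_iff_ne_zero.2 (Finsupp.mem_support_iff.1 hs)
      conv_lhs => rw [← tsub_add_cancel_of_le h1]
      rw [map_add, Finsupp.degree_single]
    simp [hs, hd]
  · simp [hs]

theorem exists_isHomogeneous_alternating {σ R : Type*} [CommRing R] {r k : ℕ} {x : Fin r → σ}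
    (hx : Function.Injective x) {p : Fin r → MvPolynomial σ R}
    (hp : ∀ i, (p i).IsHomogeneous (k + 1)) (h : ∑ i, X (x i) * p i = 0) :
    ∃ q : Fin r → Fin r → MvPolynomial σ R, (∀ i j, (q i j).IsHomogeneous k) ∧
      (∀ i, q i i = 0) ∧ (∀ i j, q i j = -q j i) ∧ ∀ i, p i = ∑ j, q i j * X (x j) := by
  obtain ⟨q, hq0, hqs, hq⟩ := exists_alternating_of_sum_X_mul_eq_zero hx h
  refine ⟨fun i j => homogeneousComponent k (q i j),
    fun i j => homogeneousComponent_isHomogeneous _ _, fun i => by simp [hq0],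
    fun i j => by simp only [hqs i j, map_neg], fun i => ?_⟩
  simp_rw [← homogeneousComponent_succ_mul_X, ← map_sum, ← hq]
  exact (homogeneousComponent_eq_self (hp i)).symm

section singularSpaces

open Matrix

theorem bordered_eq_zero_of_det_eq_zero {K κ : Type*} [Field K] [Infinite K] [Fintype κ]
    [DecidableEq κ] {N : Matrix κ κ K} (hN : IsUnit N.det) (B : Matrix (κ ⊕ Unit) (κ ⊕ Unit) K)
    (h : ∀ t : K, (fromBlocks N 0 0 0 + t • B).det = 0) :
    B.toBlocks₂₂ = 0 ∧ B.toBlocks₂₁ * N⁻¹ * B.toBlocks₁₂ = 0 := by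
  have hP : (fromBlocks
      (N.map PowerSeries.C + (PowerSeries.X : PowerSeries K) • B.toBlocks₁₁.map PowerSeries.C)
      ((PowerSeries.X : PowerSeries K) • B.toBlocks₁₂.map PowerSeries.C)
      ((PowerSeries.X : PowerSeries K) • B.toBlocks₂₁.map PowerSeries.C)
      ((PowerSeries.X : PowerSeries K) • B.toBlocks₂₂.map PowerSeries.C)).det = 0 := by
    have h0 : ((fromBlocks N 0 0 0).map Polynomial.C +
        (Polynomial.X : Polynomial K) • B.map Polynomial.C).det = 0 := by
      refine Polynomial.funext fun t => ?_
      rw [← Polynomial.coe_evalRingHom, RingHom.map_det, map_zero, ← h t]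
      congr 1
      ext i j
      simpa using mul_comm _ _
    have h1 := congrArg (Polynomial.coeToPowerSeries.ringHom) h0
    rw [RingHom.map_det, map_zero] at h1
    rw [← h1]
    congr 1
    ext i j
    rcases i with i | i <;> rcases j with j | j <;>
      simpa [toBlocks₁₁, toBlocks₁₂, toBlocks₂₁, toBlocks₂₂] using mul_comm _ _
  set A : Matrix κ κ (PowerSeries K) :=
    N.map PowerSeries.C + (PowerSeries.X : PowerSeries K) • B.toBlocks₁₁.map PowerSeries.C with hA
  have hA0 : A.map PowerSeries.constantCoeff = N := by
    ext i j; simp [hA]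
  have hAu : IsUnit A.det := by
    rw [PowerSeries.isUnit_iff_constantCoeff, RingHom.map_det]
    rwa [RingHom.mapMatrix_apply, hA0]
  let _ := A.invertibleOfIsUnitDet hAu
  rw [det_fromBlocks₁₁] at hP
  have hS := (mul_eq_zero.1 hP).resolve_left hAu.ne_zero
  rw [det_unique] at hS
  have hinv : (⅟A).map PowerSeries.constantCoeff = N⁻¹ := by
    refine (inv_eq_right_inv ?_).symm
    rw [← hA0, ← Matrix.map_mul, mul_invOf_self]
    ext i j; by_cases hij : i = j <;> simp [hij, Matrix.one_apply]
  set w := (B.toBlocks₂₁.map PowerSeries.C * ⅟A * B.toBlocks₁₂.map PowerSeries.C) () () with hw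
  have hS' : PowerSeries.X * (PowerSeries.C (B.toBlocks₂₂ () ()) - PowerSeries.X * w) = 0 := by
    rw [← hS]
    rw [Matrix.sub_apply, Matrix.smul_mul, Matrix.smul_mul, Matrix.mul_smul, Matrix.smul_apply,
      Matrix.smul_apply, Matrix.smul_apply, ← hw]
    simp [mul_sub, toBlocks₂₂]
  have hz := (mul_eq_zero.1 hS').resolve_left PowerSeries.X_ne_zero
  have hz0 : B.toBlocks₂₂ () () = 0 := by
    simpa using congrArg PowerSeries.constantCoeff hz
  refine ⟨by ext ⟨⟩ ⟨⟩; exact hz0, ?_⟩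
  rw [hz0, map_zero, zero_sub, neg_eq_zero] at hz
  have hw0 := (mul_eq_zero.1 hz).resolve_left PowerSeries.X_ne_zero
  ext ⟨⟩ ⟨⟩
  have := congrArg PowerSeries.constantCoeff hw0
  rw [map_zero] at this
  rw [Matrix.zero_apply, ← this, hw, ← hinv]
  simp [Matrix.mul_apply]

theorem finrank_le_of_dotProduct_eq_zero {K κ : Type*} [Field K] [Fintype κ]
    (S : Submodule K ((κ → K) × (κ → K))) (hS : ∀ s ∈ S, s.1 ⬝ᵥ s.2 = 0) :
    Module.finrank K S ≤ Fintype.card κ := by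
  classical
  let b : LinearMap.BilinForm K ((κ → K) × (κ → K)) :=
    LinearMap.mk₂ K (fun p q => p.1 ⬝ᵥ q.2 + p.2 ⬝ᵥ q.1)
      (fun p q r => by simp [add_dotProduct]; ring) (fun c p q => by simp [mul_add])
      (fun p q r => by simp [dotProduct_add]; ring) (fun c p q => by simp [mul_add])
  have hb : ∀ p q, b p q = p.1 ⬝ᵥ q.2 + p.2 ⬝ᵥ q.1 := fun _ _ => rfl
  have hker : LinearMap.ker b = ⊥ := by
    refine (Submodule.eq_bot_iff _).2 fun p hp => ?_
    have hp' : ∀ q, b p q = 0 := fun q => by rw [LinearMap.mem_ker.1 hp]; rfl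
    refine Prod.ext (funext fun k => ?_) (funext fun k => ?_)
    · simpa [hb] using hp' (0, Pi.single k 1)
    · simpa [hb] using hp' (Pi.single k 1, 0)
  have hle : S ≤ b.orthogonal S := by
    intro s hs
    rw [LinearMap.BilinForm.mem_orthogonal_iff]
    intro t ht
    have h := hS _ (S.add_mem hs ht)
    rw [Prod.fst_add, Prod.snd_add, add_dotProduct, dotProduct_add, dotProduct_add, hS s hs,
      hS t ht] at h
    change b t s = 0
    rw [hb, dotProduct_comm t.2]
    linear_combination h
  have h1 := LinearMap.BilinForm.finrank_add_finrank_orthogonal' (B := b) S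
  have h2 := Submodule.finrank_mono hle
  rw [hker, inf_bot_eq, finrank_bot, Module.finrank_prod, Module.finrank_fintype_fun_eq_card] at h1
  omega

theorem last_col_or_row_eq_zero {K κ : Type*} [Field K] [Infinite K] [Fintype κ]
    [DecidableEq κ] (V : Submodule K (Matrix (κ ⊕ Unit) (κ ⊕ Unit) K))
    (hV : ∀ B ∈ V, B.det = 0) (h1 : fromBlocks 1 0 0 0 ∈ V)
    (hdim : Fintype.card κ * Fintype.card κ + Fintype.card κ ≤ Module.finrank K V) :
    (∀ B ∈ V, ∀ i, B i (Sum.inr ()) = 0) ∨ (∀ B ∈ V, ∀ i, B (Sum.inr ()) i = 0) := by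
  have key : ∀ N : Matrix κ κ K, IsUnit N.det → fromBlocks N 0 0 0 ∈ V → ∀ B ∈ V,
      B.toBlocks₂₂ = 0 ∧ B.toBlocks₂₁ * N⁻¹ * B.toBlocks₁₂ = 0 := fun N hN hNV B hB =>
    bordered_eq_zero_of_det_eq_zero hN B fun t => hV _ (V.add_mem hNV (V.smul_mem t hB))
  let π : Matrix (κ ⊕ Unit) (κ ⊕ Unit) K →ₗ[K] (κ → K) × (κ → K) :=
    { toFun := fun B => (fun k => B (Sum.inr ()) (Sum.inl k), fun k => B (Sum.inl k) (Sum.inr ()))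
      map_add' := fun _ _ => rfl
      map_smul' := fun _ _ => rfl }
  have hdot : ∀ B ∈ V, (π B).1 ⬝ᵥ (π B).2 = 0 := fun B hB => by
    have h := congrFun (congrFun (key 1 (by simp) h1 B hB).2 ()) ()
    rw [inv_one, Matrix.mul_one] at h
    exact h
  have hcorner : ∀ B ∈ V, B (Sum.inr ()) (Sum.inr ()) = 0 := fun B hB =>
    congrFun (congrFun (key 1 (by simp) h1 B hB).1 ()) ()
  let ρ := π.domRestrict V
  let τ : LinearMap.ker ρ →ₗ[K] Matrix κ κ K :=
    { toFun := fun B => B.1.1.toBlocks₁₁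
      map_add' := fun _ _ => rfl
      map_smul' := fun _ _ => rfl }
  have hform : ∀ B : LinearMap.ker ρ, B.1.1 = fromBlocks (τ B) 0 0 0 := fun B => by
    have hB : π B.1.1 = 0 := B.2
    ext (i | ⟨⟩) (j | ⟨⟩)
    · rfl
    · exact congrFun (congrArg Prod.snd hB) i
    · exact congrFun (congrArg Prod.fst hB) j
    · exact hcorner _ B.1.2
  have hτ : Function.Injective τ := fun B B' h =>
    Subtype.ext (Subtype.ext (by rw [hform B, hform B', h]))
  have hrange : Module.finrank K (LinearMap.range ρ) ≤ Fintype.card κ := by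
    refine finrank_le_of_dotProduct_eq_zero _ ?_
    rintro _ ⟨B, rfl⟩
    exact hdot B.1 B.2
  have hsum := LinearMap.finrank_range_add_finrank_ker ρ
  have hM : Module.finrank K (Matrix κ κ K) = Fintype.card κ * Fintype.card κ := by
    rw [Module.finrank_matrix, Module.finrank_self, mul_one]
  have hker := LinearMap.finrank_le_finrank_of_injective hτ
  have heq : Module.finrank K (LinearMap.ker ρ) = Module.finrank K (Matrix κ κ K) := by omega
  have hsurj : Function.Surjective τ := by
    refine LinearMap.range_eq_top.1 (Submodule.eq_top_of_finrank_eq ?_)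
    rw [LinearMap.finrank_range_of_inj hτ, heq]
  have hall : ∀ N : Matrix κ κ K, fromBlocks N 0 0 0 ∈ V := fun N => by
    obtain ⟨B, rfl⟩ := hsurj N
    rw [← hform]
    exact B.1.2
  have hoff : ∀ B ∈ V, ∀ k l, k ≠ l → (π B).1 k * (π B).2 l = 0 := fun B hB k l hkl => by
    have hinv : (transvection k l (-1 : K))⁻¹ = transvection k l 1 :=
      inv_eq_right_inv (by rw [transvection_mul_transvection_same _ _ hkl]; simp)
    have h := (key (transvection k l (-1)) (by rw [det_transvection_of_ne _ _ hkl]; simp)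
      (hall _) B hB).2
    rw [hinv, transvection, Matrix.mul_add, Matrix.add_mul, Matrix.mul_one] at h
    have h' := congrFun (congrFun h ()) ()
    rw [Matrix.add_apply] at h'
    have h0 : (B.toBlocks₂₁ * B.toBlocks₁₂) () () = 0 := hdot B hB
    rw [h0, zero_add] at h'
    rw [← Matrix.zero_apply (α := K) () (), ← h']
    simp [Matrix.mul_apply, single_apply, toBlocks₂₁, toBlocks₁₂, ite_and, Finset.sum_ite_eq]
    rfl
  have hprod : ∀ B ∈ V, ∀ k l, (π B).1 k * (π B).2 l = 0 := fun B hB k l => by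
    rcases ne_or_eq k l with hkl | rfl
    · exact hoff B hB k l hkl
    by_contra hne
    have h := hdot B hB
    rw [dotProduct, Finset.sum_eq_single k] at h
    · exact hne h
    · intro l _ hl
      rw [(mul_eq_zero.1 (hoff B hB k l hl.symm)).resolve_left (left_ne_zero_of_mul hne), mul_zero]
    · simp
  by_contra! hcon
  obtain ⟨⟨B, hB, i, hi⟩, ⟨B', hB', j, hj⟩⟩ := hcon
  rcases i with l | ⟨⟩
  swap
  · exact hi (hcorner B hB)
  rcases j with k | ⟨⟩
  swap
  · exact hj (hcorner B' hB')
  have e1 : (π B).1 k = 0 := (mul_eq_zero.1 (hprod B hB k l)).resolve_right hi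
  have e2 : (π B').2 l = 0 := (mul_eq_zero.1 (hprod B' hB' k l)).resolve_left hj
  have h := hprod _ (V.add_mem hB hB') k l
  rw [map_add, Prod.fst_add, Prod.snd_add, Pi.add_apply, Pi.add_apply, e1, e2, zero_add, add_zero]
    at h
  exact (mul_ne_zero hj hi) h

theorem exists_mulVec_or_vecMul_eq_zero_of_corank_one {K n : Type*} [Field K] [Infinite K]
    [Fintype n] [DecidableEq n] (V : Submodule K (Matrix n n K)) (hV : ∀ B ∈ V, B.det = 0)
    (hdim : Fintype.card n * Fintype.card n ≤ Module.finrank K V + Fintype.card n)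
    {A : Matrix n n K} (hA : A ∈ V) (i j : n) (c : K) (hM : (A + c • single i j 1).det ≠ 0) :
    ∃ u : n → K, u ≠ 0 ∧ ((∀ B ∈ V, B *ᵥ u = 0) ∨ (∀ B ∈ V, u ᵥ* B = 0)) := by
  set M := A + c • single i j 1 with hMdef
  have hMu : IsUnit M.det := isUnit_iff_ne_zero.2 hM
  set u : n → K := fun k => c * M⁻¹ k i with hu
  have hMA : M⁻¹ * A = 1 - vecMulVec u (Pi.single j 1) := by
    have h : A = M - c • single i j 1 := by rw [hMdef, add_sub_cancel_right]
    rw [h, Matrix.mul_sub, nonsing_inv_mul _ hMu]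
    congr 1
    ext k l
    rw [Matrix.mul_smul, Matrix.smul_apply, Matrix.mul_apply, Finset.sum_eq_single i]
    · by_cases hl : l = j
      · subst hl; simp [vecMulVec_apply, hu]
      · simp [vecMulVec_apply, hl, Ne.symm hl]
    · intro b _ hb
      simp [hb.symm]
    · simp
  have huj : u j = 1 := by
    have h : (1 - vecMulVec u (Pi.single j 1)).det = 0 := by
      rw [← hMA, det_mul, hV A hA, mul_zero]
    rw [vecMulVec_eq Unit, det_one_sub_mul_comm] at h
    have h' : 1 - u j = 0 := by simpa using h
    linear_combination -h'
  set P : Matrix n n K := 1 + vecMulVec (u - Pi.single j 1) (Pi.single j 1) with hP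
  have hPj : P *ᵥ Pi.single j 1 = u := by
    rw [hP, add_mulVec, one_mulVec, vecMulVec_mulVec]
    simp
  have hPdet : P.det = 1 := by
    rw [hP, vecMulVec_eq Unit, det_one_add_mul_comm]
    simp [huj]
  have hMAP : M⁻¹ * A * P = 1 - vecMulVec (Pi.single j 1) (Pi.single j 1) := by
    rw [hMA, hP, Matrix.sub_mul, Matrix.one_mul, Matrix.mul_add, Matrix.mul_one,
      vecMulVec_mul_vecMulVec]
    ext k l
    simp [vecMulVec_apply, huj]
    ring
  let e : n ≃ {k // k ≠ j} ⊕ Unit :=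
    (Equiv.optionSubtypeNe j).symm.trans (Equiv.optionEquivSumPUnit _)
  have hel : ∀ k, e.symm (Sum.inl k) = k := fun k => by simp [e]
  have her : e.symm (Sum.inr ()) = j := by simp [e]
  let φ : Matrix n n K →ₗ[K] Matrix ({k // k ≠ j} ⊕ Unit) ({k // k ≠ j} ⊕ Unit) K :=
    (reindexLinearEquiv K K e e).toLinearMap ∘ₗ LinearMap.mulRight K P ∘ₗ LinearMap.mulLeft K M⁻¹
  have hφ : ∀ B a b, φ B a b = (M⁻¹ * B * P) (e.symm a) (e.symm b) := fun _ _ _ => rfl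
  have hφinj : Function.Injective φ := by
    intro B B' hBB'
    have h : M⁻¹ * B * P = M⁻¹ * B' * P := (reindexLinearEquiv K K e e).injective hBB'
    have h' : M * (M⁻¹ * B * P) * P⁻¹ = M * (M⁻¹ * B' * P) * P⁻¹ := congrArg (M * · * P⁻¹) h
    have hPu : IsUnit P.det := by rw [hPdet]; exact isUnit_one
    simpa only [← Matrix.mul_assoc, mul_nonsing_inv _ hMu, Matrix.one_mul,
      mul_nonsing_inv_cancel_right _ _ hPu] using h'
  have hcard : Fintype.card n = Fintype.card {k // k ≠ j} + 1 := by
    rw [Fintype.card_congr e, Fintype.card_sum, Fintype.card_unit]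
  have hfin : Module.finrank K (V.map φ) = Module.finrank K V :=
    ((V.equivMapOfInjective φ hφinj).finrank_eq).symm
  have hdet : ∀ B ∈ V.map φ, B.det = 0 := by
    rintro _ ⟨B, hB, rfl⟩
    change (reindex e e (M⁻¹ * B * P)).det = 0
    rw [det_reindex_self, det_mul, det_mul, hV B hB, mul_zero, zero_mul]
  have hone : fromBlocks 1 0 0 0 ∈ V.map φ := by
    refine ⟨A, hA, ?_⟩
    ext a b
    rw [hφ, hMAP]
    rcases a with a | ⟨⟩ <;> rcases b with b | ⟨⟩
    · simp [hel, vecMulVec_apply, Matrix.one_apply, a.2, b.2, Subtype.ext_iff]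
    · simp [hel, her, vecMulVec_apply, a.2]
    · simp [hel, her, vecMulVec_apply, b.2, b.2.symm]
    · simp [her, vecMulVec_apply]
  have hle : Fintype.card {k // k ≠ j} * Fintype.card {k // k ≠ j} + Fintype.card {k // k ≠ j} ≤
      Module.finrank K (V.map φ) := by
    rw [hfin]
    rw [hcard] at hdim
    linarith
  rcases last_col_or_row_eq_zero (V.map φ) hdet hone hle with h | h
  · refine ⟨u, fun h0 => by simp [h0] at huj, Or.inl fun B hB => ?_⟩
    have h0 : (M⁻¹ * B * P) *ᵥ Pi.single j 1 = 0 := by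
      ext k
      have := h _ ⟨B, hB, rfl⟩ (e k)
      rw [hφ, her, e.symm_apply_apply] at this
      simpa using this
    rw [← mulVec_mulVec, hPj, ← mulVec_mulVec] at h0
    have := congrArg (M *ᵥ ·) h0
    simpa [← Matrix.mul_assoc, mul_nonsing_inv _ hMu] using this
  · refine ⟨Pi.single j 1 ᵥ* M⁻¹, fun h0 => ?_, Or.inr fun B hB => ?_⟩
    · have := congrFun (congrArg (· ᵥ* M) h0) j
      simp only [vecMul_vecMul, nonsing_inv_mul _ hMu] at this
      simp at this
    · have h0 : Pi.single j 1 ᵥ* (M⁻¹ * B * P) = 0 := by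
        ext k
        have := h _ ⟨B, hB, rfl⟩ (e k)
        rw [hφ, her, e.symm_apply_apply] at this
        simpa using this
      rw [← vecMul_vecMul, ← vecMul_vecMul] at h0
      have hPu : IsUnit P.det := by rw [hPdet]; exact isUnit_one
      have := congrArg (· ᵥ* P⁻¹) h0
      simpa [vecMul_vecMul, mul_nonsing_inv_cancel_right _ _ hPu] using this

theorem exists_mulVec_or_vecMul_eq_zero {K n : Type*} [Field K] [Infinite K]
    [Fintype n] [DecidableEq n] (V : Submodule K (Matrix n n K)) (hV : ∀ B ∈ V, B.det = 0)
    (hdim : Fintype.card n * Fintype.card n ≤ Module.finrank K V + Fintype.card n) :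
    ∃ u : n → K, u ≠ 0 ∧ ((∀ B ∈ V, B *ᵥ u = 0) ∨ (∀ B ∈ V, u ᵥ* B = 0)) := by
  obtain ⟨V', hle, hmax⟩ := exists_maximal_ge_of_wellFoundedGT
    (fun W : Submodule K (Matrix n n K) => ∀ B ∈ W, B.det = 0) V hV
  have hsingle : ∃ i j, single i j (1 : K) ∉ V' := by
    by_contra! h
    have h1 : (1 : Matrix n n K) ∈ V' := by
      rw [matrix_eq_sum_single (1 : Matrix n n K)]
      refine V'.sum_mem fun i _ => V'.sum_mem fun j _ => ?_
      simpa [smul_single] using V'.smul_mem ((1 : Matrix n n K) i j) (h i j)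
    simpa using hmax.1 _ h1
  obtain ⟨i, j, hij⟩ := hsingle
  have hex : ∃ A ∈ V', ∃ c : K, (A + c • single i j 1).det ≠ 0 := by
    by_contra! h
    refine hij (hmax.2 (y := V' ⊔ K ∙ single i j (1 : K)) ?_ le_sup_left
      (Submodule.mem_sup_right (Submodule.mem_span_singleton_self _)))
    intro B hB
    obtain ⟨A, hA, C, hC, rfl⟩ := Submodule.mem_sup.1 hB
    obtain ⟨c, rfl⟩ := Submodule.mem_span_singleton.1 hC
    exact h A hA c
  obtain ⟨A, hA, c, hM⟩ := hex
  obtain ⟨u, hu, h⟩ := exists_mulVec_or_vecMul_eq_zero_of_corank_one V' hmax.1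
    (hdim.trans (Nat.add_le_add_right (Submodule.finrank_mono hle) _)) hA i j c hM
  exact ⟨u, hu, h.imp (fun h B hB => h B (hle hB)) fun h B hB => h B (hle hB)⟩

theorem exists_rank_one_descent {F K n : Type*} [Field F] [Field K] [Algebra F K] [Fintype n]
    [DecidableEq n] (a : n → n → n → F) {u : n → K} (hu : u ≠ 0)
    (h : ∀ k, ∃ c : n → K, ∀ k' l,
      ∑ i, c i * algebraMap F K (a i k' l) = if k = k' then u l else 0) :
    ∃ (v : Matrix n n F) (w : n → F), IsUnit v.det ∧ w ≠ 0 ∧ ∀ i k l, a i k l = v i k * w l := by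
  choose c hc using h
  obtain ⟨l₀, hl₀⟩ := Function.ne_iff.1 hu
  rw [Pi.zero_apply] at hl₀
  have hinj := (algebraMap F K).injective
  set b : Matrix n n K := (u l₀)⁻¹ • (Matrix.of fun i k => a i k l₀).map (algebraMap F K) with hb
  have hcb : Matrix.of c * b = 1 := by
    ext k k'
    rw [hb, Matrix.mul_smul, Matrix.smul_apply, Matrix.mul_apply]
    simp only [Matrix.of_apply, Matrix.map_apply, hc, Matrix.one_apply, smul_eq_mul, mul_ite,
      mul_zero, inv_mul_cancel₀ hl₀]
  have hbc : b * Matrix.of c = 1 := mul_eq_one_comm.1 hcb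
  have hfac : ∀ i k l, algebraMap F K (a i k l) = b i k * u l := fun i k l => by
    have h1 : ∑ j, (b * Matrix.of c) i j * algebraMap F K (a j k l) = b i k * u l := by
      simp_rw [Matrix.mul_apply, Finset.sum_mul, Matrix.of_apply]
      rw [Finset.sum_comm]
      simp_rw [mul_assoc, ← Finset.mul_sum, hc]
      simp
    rw [← h1, hbc]
    simp [Matrix.one_apply]
  have hdet : IsUnit (Matrix.of fun i k => a i k l₀).det := by
    have hbu := (Matrix.isUnit_iff_isUnit_det _).1 (IsUnit.of_mul_eq_one _ hbc)
    rw [isUnit_iff_ne_zero] at hbu ⊢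
    intro h0
    apply hbu
    rw [hb, det_smul]
    change _ * ((algebraMap F K).mapMatrix _).det = 0
    rw [← RingHom.map_det, h0, map_zero, mul_zero]
  obtain ⟨i₀, k₀, hik⟩ : ∃ i k, a i k l₀ ≠ 0 := by
    by_contra! h0
    obtain ⟨k⟩ : Nonempty n := ⟨l₀⟩
    have h1 := hc k k l₀
    simp only [h0, map_zero, mul_zero, Finset.sum_const_zero, if_true] at h1
    exact hl₀ h1.symm
  refine ⟨Matrix.of fun i k => a i k l₀, fun l => a i₀ k₀ l / a i₀ k₀ l₀, hdet, ?_, ?_⟩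
  · intro h0
    simpa [hik] using congrFun h0 l₀
  · intro i k l
    rw [Matrix.of_apply, mul_div_assoc', eq_div_iff hik]
    apply hinj
    simp only [map_mul, hfac]
    ring

theorem eq_sum_C_coeff_mul_X {F σ : Type*} [CommRing F] [Fintype σ] {p : MvPolynomial σ F}
    (hp : p.IsHomogeneous 1) : p = ∑ s, C (coeff (Finsupp.single s 1) p) * X s := by
  classical
  ext d
  simp only [coeff_sum, coeff_C_mul, coeff_X]
  by_cases hd : d.degree = 1
  · obtain ⟨s, rfl⟩ := (Finsupp.sum_eq_one_iff d).1 hd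
    rw [Finset.sum_eq_single s]
    · simp
    · intro t _ hts
      simp [Finsupp.single_left_inj, hts]
    · simp
  · rw [hp.coeff_eq_zero hd, Finset.sum_eq_zero]
    intro s _
    rw [if_neg, mul_zero]
    rintro rfl
    simp at hd

theorem exists_linear_forms_eq {F : Type*} [Field F] {n : ℕ}
    {α g : Fin n → MvPolynomial (Fin n × Fin n) F} (hα : ∀ i, (α i).IsHomogeneous 1)
    (hf : detPoly F n = ∑ i, α i * g i) :
    ∃ (v : Matrix (Fin n) (Fin n) F) (w : Fin n → F), IsUnit v.det ∧ w ≠ 0 ∧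
      ((∀ i, α i = ∑ k, C (v i k) * ∑ l, C (w l) * X (k, l)) ∨
        (∀ i, α i = ∑ k, C (v i k) * ∑ l, C (w l) * X (l, k))) := by
  let K := AlgebraicClosure F
  let a : Fin n → Fin n → Fin n → F := fun i k l => coeff (Finsupp.single (k, l) 1) (α i)
  have ha : ∀ i, α i = ∑ k, ∑ l, C (a i k l) * X (k, l) := fun i => by
    conv_lhs => rw [eq_sum_C_coeff_mul_X (hα i)]
    rw [Fintype.sum_prod_type]
  let L : Fin n → Matrix (Fin n) (Fin n) K →ₗ[K] K := fun i =>
    ∑ k, ∑ l, algebraMap F K (a i k l) • entryLinearMap K K k l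
  have hL : ∀ i B, L i B = ∑ k, ∑ l, algebraMap F K (a i k l) * B k l := fun i B => by
    simp only [L, LinearMap.sum_apply, LinearMap.smul_apply, entryLinearMap_apply, smul_eq_mul]
  have hLs : ∀ i k l, L i (single k l 1) = algebraMap F K (a i k l) := fun i k l => by
    rw [hL]
    simp [single_apply, ite_and]
  have hdet : ∀ B ∈ LinearMap.ker (LinearMap.pi L), B.det = 0 := fun B hB => by
    have hB' : ∀ i, L i B = 0 := fun i => congrFun (LinearMap.mem_ker.1 hB) i
    have h := congrArg (aeval fun p : Fin n × Fin n => B p.1 p.2) hf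
    rw [detPoly, AlgHom.map_det, map_sum] at h
    have hBeq : (aeval fun p : Fin n × Fin n => B p.1 p.2).mapMatrix
        (Matrix.of fun i j => (X (i, j) : MvPolynomial (Fin n × Fin n) F)) = B := by
      ext i j
      simp
    rw [hBeq] at h
    rw [h]
    refine Finset.sum_eq_zero fun i _ => ?_
    rw [map_mul]
    have : aeval (fun p : Fin n × Fin n => B p.1 p.2) (α i) = 0 := by
      rw [ha i, ← hB' i, hL]
      simp
    rw [this, zero_mul]
  have hdim : Fintype.card (Fin n) * Fintype.card (Fin n) ≤
      Module.finrank K (LinearMap.ker (LinearMap.pi L)) + Fintype.card (Fin n) := by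
    have h1 := LinearMap.finrank_range_add_finrank_ker (LinearMap.pi L)
    have h2 := Submodule.finrank_le (LinearMap.range (LinearMap.pi L))
    rw [Module.finrank_matrix, Module.finrank_self, mul_one] at h1
    rw [Module.finrank_fintype_fun_eq_card] at h2
    omega
  have hspan : ∀ E : Matrix (Fin n) (Fin n) K →ₗ[K] K,
      (∀ B ∈ LinearMap.ker (LinearMap.pi L), E B = 0) →
      ∃ c : Fin n → K, ∀ k l, ∑ i, c i * algebraMap F K (a i k l) = E (single k l 1) := by
    intro E hE
    have hmem : E ∈ Submodule.span K (Set.range L) := by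
      refine mem_span_of_iInf_ker_le_ker fun B hB => hE B ?_
      rwa [LinearMap.ker_pi]
    obtain ⟨c, rfl⟩ := (Submodule.mem_span_range_iff_exists_fun K).1 hmem
    exact ⟨c, fun k l => by simp [LinearMap.sum_apply, hLs]⟩
  obtain ⟨u, hu, h | h⟩ := exists_mulVec_or_vecMul_eq_zero _ hdet hdim
  · obtain ⟨v, w, hv, hw, hvw⟩ := exists_rank_one_descent a hu fun k => by
      obtain ⟨c, hc⟩ := hspan (LinearMap.proj k ∘ₗ (mulVecBilin K K).flip u)
        fun B hB => congrFun (h B hB) k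
      refine ⟨c, fun k' l => ?_⟩
      rw [hc]
      change (single k' l 1 *ᵥ u) k = _
      simp [mulVec, dotProduct, single_apply, ite_and, eq_comm]
    refine ⟨v, w, hv, hw, Or.inl fun i => ?_⟩
    simp_rw [ha i, hvw, Finset.mul_sum, map_mul, mul_assoc]
  · obtain ⟨v, w, hv, hw, hvw⟩ := exists_rank_one_descent (fun i k l => a i l k) hu fun k => by
      obtain ⟨c, hc⟩ := hspan (LinearMap.proj k ∘ₗ vecMulBilin K K u)
        fun B hB => congrFun (h B hB) k
      refine ⟨c, fun k' l => ?_⟩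
      rw [hc]
      change (u ᵥ* single l k' 1) k = _
      simp [vecMul, dotProduct, single_apply, ite_and, eq_comm]
    refine ⟨v, w, hv, hw, Or.inr fun i => ?_⟩
    rw [ha i, Finset.sum_comm]
    simp_rw [hvw, Finset.mul_sum, map_mul, mul_assoc]

end singularSpaces

namespace SliceEquiv

variable {F σ : Type*} [Field F] [Fintype σ] [DecidableEq σ] {f : MvPolynomial σ F} {d r : ℕ}

theorem trans {p q s : (Fin r → MvPolynomial σ F) × (Fin r → MvPolynomial σ F)}
    (h : SliceEquiv f d r p q) (h' : SliceEquiv f d r q s) : SliceEquiv f d r p s :=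
  ⟨h.1.trans h'.1, h'.2.trans h.2⟩

theorem of_symm (α g : Fin r → MvPolynomial σ F) {A B : Matrix σ σ F} (hA : substVar A f = f)
    (hB : substVar B f = f) (hBA : ∀ p, substVar B (substVar A p) = p) :
    SliceEquiv f d r (α, g) (fun i => substVar A (α i), fun i => substVar A (g i)) := by
  refine ⟨.single ?_, .single (.symm α g A hA)⟩
  have h := SliceStep.symm (f := f) (d := d) (fun i => substVar A (α i))
    (fun i => substVar A (g i)) B hB
  simpa only [hBA] using h

theorem of_linear (α g β : Fin r → MvPolynomial σ F) {v : Matrix (Fin r) (Fin r) F}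
    (hv : IsUnit v.det) (hα : ∀ i, (α i).IsHomogeneous 1) (hβ : ∀ i, (β i).IsHomogeneous 1)
    (h : ∀ i, α i = ∑ j, C (v i j) * β j) :
    SliceEquiv f d r (α, g) (β, fun j => ∑ i, C (v i j) * g i) := by
  have hcomp : ∀ (x y : Matrix (Fin r) (Fin r) F) (p : Fin r → MvPolynomial σ F) (i : Fin r),
      ∑ j, C (x i j) * ∑ k, C (y j k) * p k = ∑ k, C ((x * y) i k) * p k := fun x y p i => by
    simp_rw [Matrix.mul_apply, map_sum, map_mul, Finset.sum_mul, Finset.mul_sum, mul_assoc]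
    exact Finset.sum_comm
  have hone : ∀ (p : Fin r → MvPolynomial σ F) (i : Fin r),
      ∑ k, C ((1 : Matrix (Fin r) (Fin r) F) i k) * p k = p i := fun p i => by
    simp [Matrix.one_apply]
  refine ⟨.single ?_, .single (.linear α g β v hβ h)⟩
  have hstep := SliceStep.linear (f := f) (d := d) β (fun j => ∑ i, C (v i j) * g i) α
    (fun i j => v⁻¹ i j) hα fun j => by
      simp_rw [h]
      exact ((hcomp v⁻¹ v β j).trans (by rw [Matrix.nonsing_inv_mul _ hv, hone])).symm
  convert hstep using 2
  ext1 i
  have := hcomp v⁻¹.transpose v.transpose g i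
  simp only [Matrix.transpose_apply] at this
  refine (this.trans ?_).symm
  rw [← Matrix.transpose_mul, Matrix.mul_nonsing_inv _ hv, Matrix.transpose_one, hone]

theorem of_syzygy (α g h : Fin r → MvPolynomial σ F) (q : Fin r → Fin r → MvPolynomial σ F)
    (hq : ∀ i j, (q i j).IsHomogeneous (d - 2)) (hdiag : ∀ i, q i i = 0)
    (hskew : ∀ i j, q i j = -q j i) (hgh : ∀ i, g i - h i = ∑ j, q i j * α j) :
    SliceEquiv f d r (α, g) (α, h) := by
  have herase : ∀ i, ∑ j ∈ Finset.univ.erase i, q i j * α j = g i - h i := fun i => by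
    rw [hgh, Finset.sum_erase]
    rw [hdiag, zero_mul]
  constructor
  · have hstep := SliceStep.syzygy (f := f) (d := d) α h (fun i j => -q i j)
      (fun i j => (hq i j).neg) (fun i => by rw [hdiag, neg_zero])
      (fun i j => by rw [← hskew, hskew j i, neg_neg])
    refine .single ?_
    convert hstep using 2
    ext1 i
    simp only [neg_mul, Finset.sum_neg_distrib, herase]
    ring
  · have hstep := SliceStep.syzygy (f := f) (d := d) α g q hq hdiag hskew
    refine .single ?_
    convert hstep using 2
    ext1 i
    rw [herase]
    ring

end SliceEquiv

theorem laplaceh_isHomogeneous (F : Type*) [Field F] (m : ℕ) (j : Fin (m + 2)) :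
    (laplaceh F m j).IsHomogeneous (m + 1) := by
  have hdet : ((Matrix.of fun i k =>
      (X (i, k) : MvPolynomial (Fin (m + 2) × Fin (m + 2)) F)).submatrix
      Fin.succ j.succAbove).det.IsHomogeneous (m + 1) := by
    rw [Matrix.det_apply']
    refine IsHomogeneous.sum _ _ _ fun σ _ => ?_
    have hprod := IsHomogeneous.prod Finset.univ
      (fun i => (X ((σ i).succ, j.succAbove i) : MvPolynomial (Fin (m + 2) × Fin (m + 2)) F))
      (fun _ => 1) fun i _ => isHomogeneous_X _ _
    simpa using hprod.C_mul (Equiv.Perm.sign σ : ℤ)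
  simpa [laplaceh] using hdet.C_mul ((-1) ^ (j : ℕ))

theorem detPoly_eq_sum_laplace (F : Type*) [Field F] (m : ℕ) :
    detPoly F (m + 2) = ∑ j, X (0, j) * laplaceh F m j := by
  rw [detPoly, Matrix.det_succ_row_zero]
  refine Finset.sum_congr rfl fun j _ => ?_
  rw [laplaceh, Matrix.of_apply]
  ring

section substVar

variable {F σ : Type*} [Field F] [Fintype σ]

theorem substVar_isHomogeneous (A : Matrix σ σ F) {p : MvPolynomial σ F} {k : ℕ}
    (hp : p.IsHomogeneous k) : (substVar A p).IsHomogeneous k := by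
  have h := hp.aeval (fun s => ∑ t : σ, C (A s t) * X t)
    fun s => IsHomogeneous.sum _ _ _ fun t _ => isHomogeneous_C_mul_X _ _
  rwa [one_mul] at h

theorem substVar_mul_cancel [DecidableEq σ] {A B : Matrix σ σ F} (h : A * B = 1)
    (p : MvPolynomial σ F) : substVar B (substVar A p) = p := by
  have hcomp : (aeval (R := F) fun s => ∑ t, C (B s t) * (X t : MvPolynomial σ F)).comp
      (aeval fun s => ∑ t, C (A s t) * (X t : MvPolynomial σ F)) = AlgHom.id F _ := by
    ext1 s
    have hs : ∑ u, C ((A * B) s u) * X u = (X s : MvPolynomial σ F) := by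
      rw [h]
      simp [Matrix.one_apply]
    refine Eq.trans ?_ hs
    simp only [AlgHom.comp_apply, aeval_X, map_sum, map_mul, algHom_C, algebraMap_eq,
      Matrix.mul_apply, Finset.sum_mul, Finset.mul_sum, mul_assoc]
    exact Finset.sum_comm
  exact DFunLike.congr_fun hcomp p

end substVar

section rowOperation

open scoped Kronecker

variable {F : Type*} [Field F] {n : ℕ}

theorem substVar_kronecker_one_X (Q : Matrix (Fin n) (Fin n) F) (k l : Fin n) :
    substVar (Q ⊗ₖ (1 : Matrix (Fin n) (Fin n) F)) (X (k, l)) = ∑ t, C (Q k t) * X (t, l) := by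
  simp [substVar, Fintype.sum_prod_type, Matrix.kroneckerMap_apply, Matrix.one_apply, apply_ite C,
    ite_mul]

theorem substVar_kronecker_one_detPoly {Q : Matrix (Fin n) (Fin n) F} (hQ : Q.det = 1) :
    substVar (Q ⊗ₖ (1 : Matrix (Fin n) (Fin n) F)) (detPoly F n) = detPoly F n := by
  have h : (aeval fun s => ∑ t, C ((Q ⊗ₖ (1 : Matrix (Fin n) (Fin n) F)) s t) * X t).mapMatrix
      (Matrix.of fun i j => (X (i, j) : MvPolynomial (Fin n × Fin n) F)) =
      Q.map C * Matrix.of fun i j => X (i, j) := by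
    ext1 k l
    exact (substVar_kronecker_one_X Q k l).trans (by simp [Matrix.mul_apply])
  rw [substVar, detPoly, AlgHom.map_det, h, Matrix.det_mul]
  change ((C : F →+* MvPolynomial (Fin n × Fin n) F).mapMatrix Q).det * _ = _
  rw [← RingHom.map_det, hQ, map_one, one_mul]

theorem kronecker_one_mul_kronecker_one {Q R : Matrix (Fin n) (Fin n) F} (h : Q * R = 1) :
    (Q ⊗ₖ (1 : Matrix (Fin n) (Fin n) F)) * (R ⊗ₖ (1 : Matrix (Fin n) (Fin n) F)) = 1 := by
  rw [← Matrix.mul_kronecker_mul, h, Matrix.one_mul, Matrix.one_kronecker_one]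

end rowOperation

section transposition

variable {F : Type*} [Field F] {n : ℕ}

/-- The linear map on variables that transposes the matrix of variables. -/
def transposeVar (F : Type*) [Field F] (n : ℕ) : Matrix (Fin n × Fin n) (Fin n × Fin n) F :=
  (1 : Matrix (Fin n × Fin n) (Fin n × Fin n) F).submatrix Prod.swap id

theorem transposeVar_mul_self : transposeVar F n * transposeVar F n = 1 := by
  have h := Matrix.submatrix_mul_equiv (1 : Matrix (Fin n × Fin n) (Fin n × Fin n) F)
    (transposeVar F n) Prod.swap (Equiv.refl _) id
  rw [Matrix.one_mul] at h
  refine h.trans ?_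
  ext i j
  change (1 : Matrix (Fin n × Fin n) (Fin n × Fin n) F) i.swap.swap j = _
  rw [Prod.swap_swap]

theorem substVar_transposeVar_X (k l : Fin n) :
    substVar (transposeVar F n) (X (k, l)) = X (l, k) := by
  simp [substVar, transposeVar, Matrix.one_apply]

theorem substVar_transposeVar_detPoly :
    substVar (transposeVar F n) (detPoly F n) = detPoly F n := by
  rw [substVar, detPoly, AlgHom.map_det, ← Matrix.det_transpose]
  congr 1
  ext1 k l
  exact substVar_transposeVar_X l k

end transposition

theorem exists_det_eq_one_row_zero {F : Type*} [Field F] {n : ℕ} {w : Fin (n + 1) → F}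
    (hw : w ≠ 0) : ∃ (R : Matrix (Fin (n + 1)) (Fin (n + 1)) F) (c : F), R.det = 1 ∧ c ≠ 0 ∧
      w = c • R 0 := by
  obtain ⟨j, hj⟩ := Function.ne_iff.1 hw
  set M : Matrix (Fin (n + 1)) (Fin (n + 1)) F := Matrix.of fun k => Pi.single (Equiv.swap 0 j k) 1
  have hdet : (M.updateRow 0 w).det ≠ 0 := by
    intro h0
    obtain ⟨y, hy, hMy⟩ := Matrix.exists_mulVec_eq_zero_iff.2 h0
    have hyl : ∀ l, l ≠ j → y l = 0 := fun l hl => by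
      have hne : Equiv.swap 0 j l ≠ 0 := fun h =>
        hl ((Equiv.swap 0 j).injective (h.trans (Equiv.swap_apply_right 0 j).symm))
      have := congrFun hMy (Equiv.swap 0 j l)
      simpa [Matrix.mulVec, hne, M] using this
    have hyj : w j * y j = 0 := by
      have := congrFun hMy 0
      rw [Matrix.mulVec, Matrix.updateRow_self, dotProduct, Finset.sum_eq_single j] at this
      · exact this
      · intro l _ hl
        rw [hyl l hl, mul_zero]
      · simp
    refine hy (funext fun l => ?_)
    by_cases hl : l = j
    · rw [hl]
      exact (mul_eq_zero.1 hyj).resolve_left hj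
    · exact hyl l hl
  refine ⟨M.updateRow 0 ((M.updateRow 0 w).det⁻¹ • w), (M.updateRow 0 w).det, ?_, hdet, ?_⟩
  · rw [Matrix.det_updateRow_smul, inv_mul_cancel₀ hdet]
  · rw [Matrix.updateRow_self, smul_inv_smul₀ hdet]

theorem sliceEquiv_laplace_of_laplaceβ {F : Type*} [Field F] (m : ℕ)
    (h : Fin (m + 2) → MvPolynomial (Fin (m + 2) × Fin (m + 2)) F)
    (hh : ∀ i, (h i).IsHomogeneous (m + 1)) (hf : detPoly F (m + 2) = ∑ j, X (0, j) * h j) :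
    SliceEquiv (detPoly F (m + 2)) (m + 2) (m + 2) (laplaceβ F m, h)
      (laplaceβ F m, laplaceh F m) := by
  obtain ⟨q, hq, hq0, hqs, hqh⟩ := exists_isHomogeneous_alternating
    (x := fun j : Fin (m + 2) => ((0 : Fin (m + 2)), j)) (fun i j hij => (Prod.ext_iff.1 hij).2)
    (p := fun j => h j - laplaceh F m j) (fun j => (hh j).sub (laplaceh_isHomogeneous F m j)) (by
      simp_rw [mul_sub]
      rw [Finset.sum_sub_distrib, ← hf, ← detPoly_eq_sum_laplace, sub_self])
  exact .of_syzygy _ _ _ q hq hq0 hqs hqh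

theorem sliceEquiv_laplace_of_row {F : Type*} [Field F] (m : ℕ)
    {α g : Fin (m + 2) → MvPolynomial (Fin (m + 2) × Fin (m + 2)) F}
    (hαg : IsSliceDecomp (detPoly F (m + 2)) (m + 2) (m + 2) α g)
    {v : Matrix (Fin (m + 2)) (Fin (m + 2)) F} {w : Fin (m + 2) → F} (hv : IsUnit v.det)
    (hw : w ≠ 0) (h : ∀ i, α i = ∑ k, C (v i k) * ∑ l, C (w l) * X (l, k)) :
    SliceEquiv (detPoly F (m + 2)) (m + 2) (m + 2) (α, g) (laplaceβ F m, laplaceh F m) := by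
  obtain ⟨hα, hg, hf⟩ := hαg
  obtain ⟨R, c, hR, hc, rfl⟩ := exists_det_eq_one_row_zero hw
  have hRu : IsUnit R.det := by rw [hR]; exact isUnit_one
  have hQ : R⁻¹.det = 1 := by rw [Matrix.det_nonsing_inv, hR, Ring.inverse_one]
  have hrow : ∀ t, ∑ l, R 0 l * R⁻¹ l t = if t = 0 then 1 else 0 := fun t => by
    rw [← Matrix.mul_apply, Matrix.mul_nonsing_inv _ hRu, Matrix.one_apply]
    simp [eq_comm]
  set A := Matrix.kronecker R⁻¹ (1 : Matrix (Fin (m + 2)) (Fin (m + 2)) F)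
  have hlin : ∀ i, substVar A (α i) = ∑ k, C ((c • v) i k) * laplaceβ F m k := fun i => by
    have hX : ∀ k, ∑ l, C ((c • R 0) l) * substVar A (X (l, k)) = C c * laplaceβ F m k :=
      fun k => by
        have hA : ∀ l, substVar A (X (l, k)) = ∑ t, C (R⁻¹ l t) * X (t, k) :=
          fun l => substVar_kronecker_one_X _ l k
        calc ∑ l, C ((c • R 0) l) * substVar A (X (l, k))
            = ∑ t, C (c * ∑ l, R 0 l * R⁻¹ l t) * X (t, k) := by
              simp_rw [hA, Finset.mul_sum, map_sum, Finset.sum_mul]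
              rw [Finset.sum_comm]
              refine Finset.sum_congr rfl fun t _ => Finset.sum_congr rfl fun l _ => ?_
              rw [Pi.smul_apply, smul_eq_mul, C_mul, C_mul, C_mul]
              ring
          _ = C c * laplaceβ F m k := by simp [hrow, laplaceβ, apply_ite C, ite_mul]
    have hsub : substVar A (α i) =
        ∑ k, C (v i k) * ∑ l, C ((c • R 0) l) * substVar A (X (l, k)) := by
      rw [h i]
      simp [substVar, algHom_C]
    rw [hsub]
    simp_rw [hX, ← mul_assoc, ← C_mul, Matrix.smul_apply, smul_eq_mul, mul_comm c]
  have hcv : IsUnit (c • v).det := by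
    rw [Matrix.det_smul]
    exact ((isUnit_iff_ne_zero.2 hc).pow _).mul hv
  have hβ : ∀ j, (laplaceβ F m j).IsHomogeneous 1 := fun j => isHomogeneous_X _ _
  have hdet := substVar_kronecker_one_detPoly hQ
  refine (SliceEquiv.of_symm α g hdet (substVar_kronecker_one_detPoly hR)
    (substVar_mul_cancel (kronecker_one_mul_kronecker_one
      (Matrix.nonsing_inv_mul _ hRu)))).trans ?_
  refine (SliceEquiv.of_linear _ (fun i => substVar A (g i)) _ hcv
    (fun i => substVar_isHomogeneous A (hα i)) hβ hlin).trans ?_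
  refine sliceEquiv_laplace_of_laplaceβ m _ (fun j => IsHomogeneous.sum _ _ _ fun i _ =>
    (substVar_isHomogeneous A (hg i)).C_mul _) ?_
  have hsum : substVar A (detPoly F (m + 2)) = ∑ i, substVar A (α i) * substVar A (g i) := by
    rw [hf]
    simp [substVar]
  refine hdet.symm.trans (hsum.trans ?_)
  simp_rw [hlin, Finset.sum_mul, Finset.mul_sum]
  rw [Finset.sum_comm]
  refine Finset.sum_congr rfl fun k _ => Finset.sum_congr rfl fun i _ => ?_
  rw [laplaceβ]
  ring

theorem slice_decomp_det_equiv_laplace {F : Type*} [Field F] (m : ℕ)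
    (α g : Fin (m + 2) → MvPolynomial (Fin (m + 2) × Fin (m + 2)) F)
    (hαg : IsSliceDecomp (detPoly F (m + 2)) (m + 2) (m + 2) α g) :
    SliceEquiv (detPoly F (m + 2)) (m + 2) (m + 2) (α, g) (laplaceβ F m, laplaceh F m) := by
  obtain ⟨v, w, hv, hw, h | h⟩ := exists_linear_forms_eq hαg.1 hαg.2.2
  · refine (SliceEquiv.of_symm α g substVar_transposeVar_detPoly substVar_transposeVar_detPoly
      (substVar_mul_cancel transposeVar_mul_self)).trans ?_
    refine sliceEquiv_laplace_of_row m ⟨fun i => substVar_isHomogeneous _ (hαg.1 i),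
      fun i => substVar_isHomogeneous _ (hαg.2.1 i), ?_⟩ hv hw fun i => ?_
    · rw [← substVar_transposeVar_detPoly, hαg.2.2]
      simp [substVar]
    · have hX := substVar_transposeVar_X (F := F) (n := m + 2)
      simp only [substVar] at hX
      rw [h i]
      simp only [substVar, map_sum, map_mul, algHom_C, algebraMap_eq, hX]
  · exact sliceEquiv_laplace_of_row m hαg hv hw h
end

section
/- Let F be a field, let d ≥ 2, let β_1,...,β_r be linearly independent linear forms (homogeneous degree-1 polynomials in finitely many variables over F), and let t_1,...,t_r be homogeneous polynomials of degree d−1 satisfying Σ_{j=1}^r β_j t_j = 0. Then there exist homogeneous polynomials q_{i,j} of degree d−2 (for i ≠ j) satisfying q_{i,j} = −q_{j,i} for all i ≠ j, such that t_j = Σ_{i≠j} q_{i,j} β_i for every j. -/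
open MvPolynomial

/-- If every `β a` is a nonzerodivisor modulo any finite set of the other `β i`, then the syzygies of
`β` are generated by the Koszul syzygies. -/
theorem exists_alternating_of_sum_mul_eq_zero {R ι : Type*} [CommRing R] [DecidableEq ι]
    (β : ι → R)
    (hreg : ∀ (s : Finset ι) (a : ι), a ∉ s → ∀ x : R,
      β a * x ∈ Ideal.span (β '' s) → x ∈ Ideal.span (β '' s))
    (s : Finset ι) (t : ι → R) (hsum : ∑ j ∈ s, β j * t j = 0) :
    ∃ q : ι → ι → R, (∀ i, q i i = 0) ∧ (∀ i j, q i j = -q j i) ∧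
      ∀ j ∈ s, t j = ∑ i ∈ s, q i j * β i := by
  induction s using Finset.induction_on generalizing t with
  | empty => exact ⟨0, by simp⟩
  | insert a s ha ih =>
    rw [Finset.sum_insert ha] at hsum
    have hta : t a ∈ Ideal.span (β '' s) := by
      refine hreg s a ha _ ?_
      rw [eq_neg_of_add_eq_zero_left hsum]
      exact neg_mem (sum_mem fun j hj ↦
        Ideal.mul_mem_right _ _ (Ideal.subset_span ⟨j, hj, rfl⟩))
    obtain ⟨c, hc⟩ := Submodule.mem_span_image_finset_iff_exists_fun' R |>.1 hta
    simp only [smul_eq_mul] at hc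
    obtain ⟨q, hq0, hqneg, hq⟩ := ih (fun j ↦ t j + c j * β a) (by
      rw [← hsum, ← hc, Finset.mul_sum, ← Finset.sum_add_distrib]
      exact Finset.sum_congr rfl fun j _ ↦ by ring)
    refine ⟨fun i j ↦ if i = a then (if j = a then 0 else -c j) else
      if j = a then c i else q i j, fun i ↦ ?_, fun i j ↦ ?_, fun j hj ↦ ?_⟩
    · by_cases hi : i = a <;> simp [hi, hq0]
    · by_cases hi : i = a <;> by_cases hj : j = a <;> simp [hi, hj, ← hqneg i j]
    · have hne : ∀ i ∈ s, i ≠ a := fun i hi h ↦ ha (h ▸ hi)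
      rw [Finset.sum_insert ha]
      rcases Finset.mem_insert.1 hj with rfl | hj
      · simp only [if_true, zero_mul, zero_add]
        rw [← hc]
        exact Finset.sum_congr rfl fun i hi ↦ by simp only [if_neg (hne i hi)]
      · simp only [if_true, if_neg (hne j hj)]
        have h : ∑ i ∈ s, (if i = a then -c j else q i j) * β i = t j + c j * β a := by
          rw [hq j hj]
          exact Finset.sum_congr rfl fun i hi ↦ by rw [if_neg (hne i hi)]
        rw [h]
        ring

namespace MvPolynomial

variable {F σ : Type*}

/-- Substituting for each variable something congruent to it modulo `I` does not change a polynomial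
modulo `I`. -/
theorem sub_aeval_mem [CommRing F] {I : Ideal (MvPolynomial σ F)} {g : σ → MvPolynomial σ F}
    (hg : ∀ i, X i - g i ∈ I) (p : MvPolynomial σ F) : p - aeval g p ∈ I := by
  have h : (Ideal.Quotient.mkₐ F I).comp (aeval g) = Ideal.Quotient.mkₐ F I :=
    algHom_ext fun i ↦ by
      simpa using (Ideal.Quotient.eq.2 (hg i)).symm
  exact Ideal.Quotient.eq.1 (DFunLike.congr_fun h p).symm

theorem aeval_linearMap_X_of_isHomogeneous_one [CommSemiring F]
    (P : MvPolynomial σ F →ₗ[F] MvPolynomial σ F) {p : MvPolynomial σ F}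
    (hp : p.IsHomogeneous 1) : aeval (fun i ↦ P (X i)) p = P p := by
  rw [← mem_homogeneousSubmodule, homogeneousSubmodule_one_eq_span_X] at hp
  refine LinearMap.eqOn_span (f := (aeval fun i ↦ P (X i)).toLinearMap) (g := P) ?_ hp
  rintro _ ⟨i, rfl⟩
  simp

/-- A linear form is a nonzerodivisor modulo linear forms that are linearly independent of it. -/
theorem mem_span_of_linearForm_mul_mem [Field F] {ι : Type*} {β : ι → MvPolynomial σ F}
    (hlin : ∀ j, (β j).IsHomogeneous 1) (hind : LinearIndependent F β)
    (s : Finset ι) {a : ι} (ha : a ∉ s) {x : MvPolynomial σ F}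
    (hx : β a * x ∈ Ideal.span (β '' s)) : x ∈ Ideal.span (β '' s) := by
  classical
  obtain ⟨f, hf⟩ := LinearMap.exists_leftInverse_of_injective
    (Finsupp.linearCombination F β) (LinearMap.ker_eq_bot.2 hind)
  have hfβ (j : ι) : f (β j) = Finsupp.single j 1 := by
    simpa using DFunLike.congr_fun hf (Finsupp.single j 1)
  let P : MvPolynomial σ F →ₗ[F] MvPolynomial σ F :=
    LinearMap.id - ∑ i ∈ s, (Finsupp.lapply i ∘ₗ f).smulRight (β i)
  have hP (p : MvPolynomial σ F) : P p = p - ∑ i ∈ s, f p i • β i := by simp [P]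
  have hPs (j : ι) (hj : j ∈ s) : P (β j) = 0 := by
    simp [hP, hfβ, Finsupp.single_apply, ite_smul, hj]
  have hPa : P (β a) = β a := by
    simp [hP, hfβ, Finsupp.single_apply, ite_smul, ha]
  have hker : Ideal.span (β '' s) ≤ RingHom.ker (aeval (R := F) fun i ↦ P (X i)) := by
    rw [Ideal.span_le]
    rintro _ ⟨j, hj, rfl⟩
    exact (aeval_linearMap_X_of_isHomogeneous_one P (hlin j)).trans (hPs j hj)
  have hzero : aeval (fun i ↦ P (X i)) x = 0 := by
    have h : aeval (fun i ↦ P (X i)) (β a * x) = 0 := hker hx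
    rw [map_mul, aeval_linearMap_X_of_isHomogeneous_one P (hlin a), hPa] at h
    exact (mul_eq_zero.1 h).resolve_left (hind.ne_zero a)
  rw [← sub_zero x, ← hzero]
  refine sub_aeval_mem (fun i ↦ ?_) x
  rw [hP, sub_sub_cancel]
  exact sum_mem fun j hj ↦ Submodule.smul_of_tower_mem _ _ (Ideal.subset_span ⟨j, hj, rfl⟩)

theorem homogeneousComponent_add_mul_of_isHomogeneous [CommSemiring F] {m : ℕ} (n : ℕ)
    (p : MvPolynomial σ F) {q : MvPolynomial σ F} (hq : q.IsHomogeneous m) :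
    homogeneousComponent (n + m) (p * q) = homogeneousComponent n p * q := by
  let := gradedAlgebra (σ := σ) (R := F)
  simpa [← decomposition.decompose'_apply] using
    DirectSum.coe_decompose_mul_add_of_right_mem (homogeneousSubmodule σ F) (a := p) (i := n)
      ((mem_homogeneousSubmodule m q).2 hq)

end MvPolynomial

theorem syzygy_of_independent_linear_forms {F : Type*} [Field F]
    {σ : Type*} [Fintype σ] (d r : ℕ) (hd : 2 ≤ d)
    (β : Fin r → MvPolynomial σ F)
    (hβlin : ∀ j, (β j).IsHomogeneous 1)
    (hβind : LinearIndependent F β)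
    (t : Fin r → MvPolynomial σ F)
    (ht : ∀ j, (t j).IsHomogeneous (d - 1))
    (hsum : ∑ j, β j * t j = 0) :
    ∃ q : Fin r → Fin r → MvPolynomial σ F,
      (∀ i j, i ≠ j → (q i j).IsHomogeneous (d - 2)) ∧
      (∀ i j, i ≠ j → q i j = - q j i) ∧
      ∀ j, t j = ∑ i ∈ Finset.univ.erase j, q i j * β i := by
  obtain ⟨q, hq0, hqneg, hq⟩ := exists_alternating_of_sum_mul_eq_zero β
    (fun s a ha x hx ↦ mem_span_of_linearForm_mul_mem hβlin hβind s ha hx) Finset.univ t hsum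
  refine ⟨fun i j ↦ homogeneousComponent (d - 2) (q i j),
    fun i j _ ↦ homogeneousComponent_isHomogeneous _ _, fun i j _ ↦ ?_, fun j ↦ ?_⟩
  · simp only [hqneg i j, map_neg]
  · rw [Finset.sum_erase _ (by simp [hq0]), ← homogeneousComponent_eq_self (ht j),
      hq j (Finset.mem_univ j), map_sum, show d - 1 = d - 2 + 1 by omega]
    exact Finset.sum_congr rfl fun i _ ↦
      homogeneousComponent_add_mul_of_isHomogeneous _ _ (hβlin i)
end

section
/- Let f be a degree-d form over a field F, and let (α, g) and (β, h) be two slice rank decompositions of f of length r. If (α_1,...,α_r) and (β_1,...,β_r) are both bases for the same r-dimensional subspace of the space of linear forms, then the two decompositions are equivalent. -/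
open MvPolynomial

namespace MvPolynomial

variable {F σ : Type*} [Field F]

/-- An ideal generated by linear forms is the kernel of an endomorphism of the polynomial ring
whose values on linear forms vanish exactly on the linear span of the generators. -/
theorem exists_algHom_ker_eq_span_linearForms {ι : Type*} (α : ι → MvPolynomial σ F)
    (hα : ∀ i, (α i).IsHomogeneous 1) :
    ∃ π : MvPolynomial σ F →ₐ[F] MvPolynomial σ F,
      RingHom.ker π = Ideal.span (Set.range α) ∧
      ∀ p, p.IsHomogeneous 1 → π p = 0 → p ∈ Submodule.span F (Set.range α) := by
  set S := Submodule.span F (Set.range α)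
  obtain ⟨ρ, hρ⟩ := S.subtype.exists_leftInverse_of_injective S.ker_subtype
  have hρS (p : MvPolynomial σ F) (hp : p ∈ S) : (ρ p : MvPolynomial σ F) = p :=
    congrArg Subtype.val (LinearMap.congr_fun hρ ⟨p, hp⟩)
  let π : MvPolynomial σ F →ₐ[F] MvPolynomial σ F := aeval fun s => X s - (ρ (X s) : MvPolynomial σ F)
  have hπ (p : MvPolynomial σ F) (hp : p.IsHomogeneous 1) : π p = p - ρ p := by
    refine Submodule.span_induction (p := fun p _ => π p = p - ρ p) ?_ ?_ ?_ ?_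
      (homogeneousSubmodule_one_eq_span_X (σ := σ) (R := F) ▸ (mem_homogeneousSubmodule 1 p).mpr hp)
    · rintro _ ⟨s, rfl⟩
      simp [π]
    · simp
    · intro x y _ _ hx hy
      simp only [map_add, hx, hy, Submodule.coe_add]
      ring
    · intro a x _ hx
      simp only [map_smul, hx, Submodule.coe_smul, smul_sub]
  have hSI : ∀ p ∈ S, p ∈ Ideal.span (Set.range α) := fun p hp =>
    Submodule.span_le_restrictScalars F (MvPolynomial σ F) _ hp
  have hmod : (Ideal.Quotient.mkₐ F (Ideal.span (Set.range α))).comp π =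
      Ideal.Quotient.mkₐ F (Ideal.span (Set.range α)) := by
    ext s
    simp only [AlgHom.comp_apply, Ideal.Quotient.mkₐ_eq_mk, π, aeval_X]
    rw [Ideal.Quotient.eq]
    simpa using hSI _ (ρ (X s)).2
  refine ⟨π, le_antisymm (fun p hp => ?_) ?_, fun p hp h0 => ?_⟩
  · have := AlgHom.congr_fun hmod p
    rw [AlgHom.comp_apply, (RingHom.mem_ker).mp hp, map_zero] at this
    exact Ideal.Quotient.eq_zero_iff_mem.mp this.symm
  · rw [Ideal.span_le]
    rintro _ ⟨i, rfl⟩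
    have : π (α i) = 0 := by
      rw [hπ _ (hα i), hρS _ (Submodule.subset_span ⟨i, rfl⟩), sub_self]
    exact this
  · rw [hπ p hp, sub_eq_zero] at h0
    rw [h0]
    exact (ρ p).2

/-- Every syzygy of linearly independent linear forms is a Koszul syzygy. -/
theorem exists_alternating_of_sum_mul_eq_zero {r : ℕ} (α e : Fin r → MvPolynomial σ F)
    (hα : ∀ i, (α i).IsHomogeneous 1) (hind : LinearIndependent F α)
    (he : ∑ i, α i * e i = 0) :
    ∃ q : Fin r → Fin r → MvPolynomial σ F,
      (∀ i, q i i = 0) ∧ (∀ i j, q i j = -q j i) ∧ ∀ i, e i = ∑ j, q i j * α j := by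
  induction r with
  | zero => exact ⟨fun _ _ => 0, by simp, by simp, fun i => i.elim0⟩
  | succ r ih =>
    rw [linearIndependent_finSucc] at hind
    obtain ⟨π, hker, hπ⟩ := exists_algHom_ker_eq_span_linearForms (Fin.tail α) fun i => hα i.succ
    rw [Fin.sum_univ_succ] at he
    have hα0 : π (α 0) ≠ 0 := fun h => hind.2 (hπ _ (hα 0) h)
    have htail : ∑ i : Fin r, α i.succ * e i.succ ∈ RingHom.ker π := by
      rw [hker]
      exact Ideal.sum_mem _ fun i _ => Ideal.mul_mem_right _ _ (Ideal.subset_span ⟨i, rfl⟩)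
    have he0 : e 0 ∈ Ideal.span (Set.range (Fin.tail α)) := by
      rw [← hker, RingHom.mem_ker]
      have := congrArg π he
      rw [map_add, (RingHom.mem_ker).mp htail, add_zero, map_mul, map_zero] at this
      exact (mul_eq_zero.mp this).resolve_left hα0
    obtain ⟨s, hs⟩ := Ideal.mem_span_range_iff_exists_fun.mp he0
    simp only [Fin.tail] at hs
    obtain ⟨q, hdiag, hskew, hq⟩ := ih (Fin.tail α) (fun i => e i.succ + s i * α 0)
      (fun i => hα i.succ) hind.1 (by
        rw [← hs, Finset.mul_sum, ← Finset.sum_add_distrib] at he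
        rw [← he]
        exact Finset.sum_congr rfl fun i _ => by simp only [Fin.tail]; ring)
    refine ⟨Fin.cons (Fin.cons 0 s) fun i => Fin.cons (-s i) (q i), ?_, ?_, ?_⟩
    · intro i
      cases i using Fin.cases <;> simp [hdiag]
    · intro i j
      cases i using Fin.cases <;> cases j using Fin.cases <;> simp [← hskew]
    · intro i
      cases i using Fin.cases with
      | zero => simp [Fin.sum_univ_succ, hs]
      | succ i =>
        have := hq i
        simp only [Fin.tail] at this
        simp only [Fin.sum_univ_succ, Fin.cons_succ, Fin.cons_zero, ← this]
        ring

theorem homogeneousComponent_succ_mul_of_isHomogeneous_one (n : ℕ) (p a : MvPolynomial σ F)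
    (ha : a.IsHomogeneous 1) :
    homogeneousComponent (n + 1) (p * a) = homogeneousComponent n p * a := by
  induction p using MvPolynomial.induction_on' with
  | monomial m c =>
    have hm : (monomial m c).IsHomogeneous m.degree := isHomogeneous_monomial c rfl
    rw [homogeneousComponent_of_mem hm, homogeneousComponent_of_mem (hm.mul ha)]
    simp only [Nat.add_right_cancel_iff, ite_mul, zero_mul]
  | add p q hp hq => simp only [add_mul, map_add, hp, hq]

end MvPolynomial

theorem sliceLE_of_linearIndependent {F σ : Type*} [Field F] [Fintype σ] [DecidableEq σ]
    (f : MvPolynomial σ F) (d r : ℕ) (α g h : Fin r → MvPolynomial σ F)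
    (hg : IsSliceDecomp f d r α g) (hh : IsSliceDecomp f d r α h)
    (hind : LinearIndependent F α) : SliceLE f d r (α, h) (α, g) := by
  obtain ⟨hα, hgd, hgf⟩ := hg
  obtain ⟨-, hhd, hhf⟩ := hh
  have he : ∑ i, α i * (g i - h i) = 0 := by
    simp only [mul_sub, Finset.sum_sub_distrib, ← hgf, ← hhf, sub_self]
  rcases Nat.lt_or_ge d 2 with hd | hd
  · have hd0 : d - 1 = 0 := by omega
    have hgh : g = h := by
      funext i
      have hC (i) : ∃ a : F, g i - h i = C a :=
        ⟨_, totalDegree_eq_zero_iff_eq_C.mp (by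
          have := ((hgd i).sub (hhd i)).totalDegree_le
          omega)⟩
      choose a ha using hC
      have ha0 := Fintype.linearIndependent_iff.mp hind a (by
        rw [← he]
        exact Finset.sum_congr rfl fun i _ => by rw [ha, smul_eq_C_mul, mul_comm]) i
      rw [← sub_eq_zero, ha, ha0, C_0]
    rw [hgh]
    exact Relation.ReflTransGen.refl
  · obtain ⟨n, rfl⟩ := Nat.exists_eq_add_of_le' hd
    obtain ⟨q, hdiag, hskew, hq⟩ := exists_alternating_of_sum_mul_eq_zero α _ hα hind he
    have hstep := SliceStep.syzygy (f := f) (d := n + 2) α g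
      (fun i j => homogeneousComponent n (q i j))
      (fun i j => homogeneousComponent_isHomogeneous n _) (fun i => by simp [hdiag])
      (fun i j => by rw [hskew i j, map_neg])
    have hh (i) : g i - ∑ j ∈ Finset.univ.erase i, homogeneousComponent n (q i j) * α j = h i := by
      have hi := congrArg (homogeneousComponent (n + 1)) (hq i)
      rw [homogeneousComponent_of_mem ((hgd i).sub (hhd i)), if_pos (by omega), map_sum] at hi
      simp only [homogeneousComponent_succ_mul_of_isHomogeneous_one n _ _ (hα _)] at hi
      rw [Finset.sum_erase _ (by simp [hdiag]), ← hi, sub_sub_cancel]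
    rw [funext hh] at hstep
    exact Relation.ReflTransGen.single hstep

theorem IsSliceDecomp.sliceLE_of_span_le {F σ : Type*} [Field F] [Fintype σ] [DecidableEq σ]
    {f : MvPolynomial σ F} {d r : ℕ} {α g β h : Fin r → MvPolynomial σ F}
    (hαg : IsSliceDecomp f d r α g) (hβh : IsSliceDecomp f d r β h)
    (hβind : LinearIndependent F β)
    (hspan : Submodule.span F (Set.range α) ≤ Submodule.span F (Set.range β)) :
    SliceLE f d r (β, h) (α, g) := by
  have hc (i) : ∃ c : Fin r → F, ∑ j, c j • β j = α i :=
    (Submodule.mem_span_range_iff_exists_fun F).mp (hspan (Submodule.subset_span ⟨i, rfl⟩))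
  choose c hc using hc
  have hc' (i) : α i = ∑ j, C (c i j) * β j := by
    simp only [← smul_eq_C_mul, hc]
  refine (sliceLE_of_linearIndependent f d r β _ h ⟨hβh.1, fun j => ?_, ?_⟩ hβh hβind).tail
    (SliceStep.linear α g β c hβh.1 hc')
  · exact IsHomogeneous.sum _ _ _ fun i _ => by
      simpa using (isHomogeneous_C σ (c i j)).mul (hαg.2.1 i)
  · rw [hαg.2.2]
    simp only [Finset.mul_sum]
    rw [Finset.sum_comm]
    refine Finset.sum_congr rfl fun i _ => ?_
    rw [hc' i, Finset.sum_mul]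
    exact Finset.sum_congr rfl fun j _ => by ring

theorem sliceEquiv_of_same_span {F : Type*} [Field F] {σ : Type*} [Fintype σ] [DecidableEq σ]
    (f : MvPolynomial σ F) (d r : ℕ) (hf : f.IsHomogeneous d)
    (α g β h : Fin r → MvPolynomial σ F)
    (hαg : IsSliceDecomp f d r α g) (hβh : IsSliceDecomp f d r β h)
    (hαind : LinearIndependent F α) (hβind : LinearIndependent F β)
    (hspan : Submodule.span F (Set.range α) = Submodule.span F (Set.range β)) :
    SliceEquiv f d r (α, g) (β, h) := by
  exact ⟨hβh.sliceLE_of_span_le hαg hαind hspan.ge, hαg.sliceLE_of_span_le hβh hβind hspan.le⟩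
end

section
/- For every field F and every n ≥ 2, every partition rank decomposition of the determinant n-linear form det_n has length r with r ≥ log₂(n) + 1 (equivalently, since r is an integer, r ≥ ⌈log₂ n⌉ + 1). In particular, prk(det_n) ≥ log₂(n) + 1. -/
/-- A partition rank decomposition of the determinant `n`-linear form of length `r`:
subsets `∅ ≠ I i ≠ univ` of the `n` vector variables, multilinear forms `Q i` in the
variables in `I i` and `R i` in the complementary variables, such that
`det(x₁,...,xₙ) = Σ i, Q i * R i`. -/
def IsPartitionDecompOfDet (F : Type*) [Field F] (n r : ℕ)
    (I : Fin r → Finset (Fin n))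
    (Q : ∀ i, MultilinearMap F (fun _ : {j : Fin n // j ∈ I i} => (Fin n → F)) F)
    (R : ∀ i, MultilinearMap F (fun _ : {j : Fin n // j ∉ I i} => (Fin n → F)) F) : Prop :=
  (∀ i, (I i).Nonempty ∧ I i ≠ Finset.univ) ∧
    ∀ x : Fin n → (Fin n → F),
      (Matrix.of x).det = ∑ i, Q i (fun j => x j.1) * R i (fun j => x j.1)

open Module in
theorem exists_mem_notMem_span_image {F V ι : Type*} [Field F] [AddCommGroup V] [Module F V]
    [FiniteDimensional F V] (x : ι → V) (s : Finset ι) (U : Submodule F V)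
    (hU : s.card < finrank F U) : ∃ v ∈ U, v ∉ Submodule.span F (x '' s) := by
  classical
  by_contra! h
  have hle : U ≤ Submodule.span F (x '' s) := h
  have hspan := finrank_span_finset_le_card (R := F) (s.image x)
  rw [Finset.coe_image] at hspan
  have hrank : finrank F U ≤ finrank F (Submodule.span F (x '' (s : Set ι))) :=
    Submodule.finrank_mono hle
  have := hrank.trans (hspan.trans Finset.card_image_le)
  omega

theorem LinearIndepOn.update_insert {F V ι : Type*} [Field F] [AddCommGroup V] [Module F V]
    [DecidableEq ι] {x : ι → V} {s : Set ι} {a : ι} {v : V} (hx : LinearIndepOn F x s)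
    (ha : a ∉ s) (hv : v ∉ Submodule.span F (x '' s)) :
    LinearIndepOn F (Function.update x a v) (insert a s) := by
  have heq : Set.EqOn x (Function.update x a v) s := fun j hj =>
    (Function.update_of_ne (ne_of_mem_of_not_mem hj ha) v x).symm
  rw [linearIndepOn_insert ha, ← heq.image_eq, Function.update_self]
  exact ⟨hx.congr heq, hv⟩

open Module in
theorem LinearIndepOn.exists_linearIndependent_eqOn {F V ι : Type*} [Field F] [AddCommGroup V]
    [Module F V] [FiniteDimensional F V] [Fintype ι] [DecidableEq ι]
    (hV : Fintype.card ι ≤ finrank F V) (S : Finset ι) (x : ι → V)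
    (hx : LinearIndepOn F x (Sᶜ : Finset ι)) :
    ∃ y : ι → V, (∀ j ∉ S, y j = x j) ∧ LinearIndependent F y := by
  induction S using Finset.induction_on generalizing x with
  | empty => exact ⟨x, fun _ _ => rfl, by simpa [linearIndepOn_univ_iff] using hx⟩
  | insert a S ha ih =>
    have hcard : ((insert a S)ᶜ : Finset ι).card < finrank F (⊤ : Submodule F V) := by
      rw [finrank_top]
      refine lt_of_lt_of_le ?_ hV
      rw [Finset.card_compl]
      have := Finset.card_le_univ (insert a S)
      have := Finset.card_pos.2 (Finset.insert_nonempty a S)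
      omega
    obtain ⟨v, -, hv⟩ := exists_mem_notMem_span_image x _ ⊤ hcard
    have hi := hx.update_insert (a := a) (by simp) hv
    have hset : insert a (((insert a S)ᶜ : Finset ι) : Set ι) = (Sᶜ : Finset ι) := by
      ext j
      by_cases hj : j = a <;> simp [hj, ha]
    rw [hset] at hi
    obtain ⟨y, hy, hyi⟩ := ih _ hi
    refine ⟨y, fun j hj => ?_, hyi⟩
    rw [Finset.mem_insert, not_or] at hj
    rw [hy j hj.2, Function.update_of_ne hj.1]

open Module in
theorem exists_mem_forall_eq_zero_notMem_span {F V ι κ : Type*} [Field F] [AddCommGroup V]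
    [Module F V] [FiniteDimensional F V] (x : ι → V) (s : Finset ι) (T : Finset κ)
    (φ : κ → V →ₗ[F] F) (h : s.card + T.card < finrank F V) :
    ∃ v, (∀ i ∈ T, φ i v = 0) ∧ v ∉ Submodule.span F (x '' s) := by
  let Φ : V →ₗ[F] (T → F) := LinearMap.pi fun i => φ i
  have hker := Φ.finrank_range_add_finrank_ker
  have hrange : finrank F (LinearMap.range Φ) ≤ T.card := by
    simpa using Submodule.finrank_le (LinearMap.range Φ)
  obtain ⟨v, hv, hvs⟩ := exists_mem_notMem_span_image x s (LinearMap.ker Φ) (by omega)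
  refine ⟨v, fun i hi => ?_, hvs⟩
  exact congrFun (LinearMap.mem_ker.1 hv) ⟨i, hi⟩

/-- Each index `i` carries two functions `P i true`, `P i false`, which depend linearly on each of
the variables in `B i true`, resp. in its complement `B i false`, and on no others. Starting from
vectors that are linearly independent off `S`, the vectors in `S` can be chosen so that the whole
family is linearly independent and each product `P i true * P i false` with `i ∈ T` vanishes. -/
theorem exists_linearIndependent_forall_exists_eq_zero {F V ι κ : Type*} [Field F]
    [AddCommGroup V] [Module F V] [FiniteDimensional F V] [Fintype ι] [DecidableEq ι]
    (hV : Fintype.card ι ≤ Module.finrank F V)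
    (B : κ → Bool → Finset ι) (hB : ∀ i b, B i (!b) = (B i b)ᶜ)
    (P : κ → Bool → (ι → V) → F)
    (hdep : ∀ i b x y, (∀ j ∈ B i b, x j = y j) → P i b x = P i b y)
    (hlin : ∀ i b x, ∀ a ∈ B i b, ∃ φ : V →ₗ[F] F, ∀ v, P i b (Function.update x a v) = φ v)
    (T : Finset κ) (S : Finset ι) (hcard : 2 ^ T.card < 2 * S.card)
    (hT : ∀ i ∈ T, ∀ b, (B i b ∩ S).Nonempty)
    (x : ι → V) (hx : LinearIndepOn F x (Sᶜ : Finset ι)) :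
    ∃ y : ι → V, (∀ j ∉ S, y j = x j) ∧ LinearIndependent F y ∧
      ∀ i ∈ T, ∃ b, P i b y = 0 := by
  classical
  induction hn : T.card using Nat.strong_induction_on generalizing T S x with
  | _ t ih =>
  subst hn
  obtain rfl | hne := T.eq_empty_or_nonempty
  · obtain ⟨y, hy, hyi⟩ := hx.exists_linearIndependent_eqOn hV S x
    exact ⟨y, hy, hyi, by simp⟩
  obtain ⟨⟨i₀, b₀⟩, hi₀, hmin⟩ := Finset.exists_min_image (T ×ˢ (Finset.univ : Finset Bool))
    (fun p => (B p.1 p.2 ∩ S).card) (hne.product Finset.univ_nonempty)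
  replace hi₀ : i₀ ∈ T := (Finset.mem_product.1 hi₀).1
  replace hmin : ∀ i ∈ T, ∀ b, (B i₀ b₀ ∩ S).card ≤ (B i b ∩ S).card := fun i hi b =>
    hmin (i, b) (Finset.mem_product.2 ⟨hi, Finset.mem_univ b⟩)
  obtain ⟨a, ha⟩ := hT i₀ hi₀ b₀
  have hhalf : 2 * (B i₀ b₀ ∩ S).card ≤ S.card := by
    have h1 := hmin i₀ hi₀ (!b₀)
    have h2 : (B i₀ b₀ ∩ S).card + (B i₀ (!b₀) ∩ S).card = S.card := by
      rw [hB, Finset.inter_comm, Finset.inter_comm _ S, ← Finset.sdiff_eq_inter_compl,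
        Finset.card_inter_add_card_sdiff]
    omega
  generalize hA : B i₀ b₀ ∩ S = A at *
  have hAS : A ⊆ S := hA ▸ Finset.inter_subset_right
  have haS := hAS ha
  let T₀ := T.filter fun i => ∃ b, B i b ∩ S = A
  have hT₀ : ∀ i ∈ T₀, ∃ b, B i b ∩ S = A := fun i hi => (Finset.mem_filter.1 hi).2
  have hT₀T : T₀ ⊆ T := Finset.filter_subset _ _
  have hT₀pos : 0 < T₀.card := Finset.card_pos.2 ⟨i₀, Finset.mem_filter.2 ⟨hi₀, b₀, hA⟩⟩
  have hT₀le : T₀.card ≤ T.card := Finset.card_le_card hT₀T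
  obtain ⟨t, ht⟩ : ∃ t, T.card = t + 1 := ⟨T.card - 1, by omega⟩
  rw [ht, pow_succ] at hcard
  have hroom : A.card + T₀.card ≤ S.card := by
    rcases t with _ | t
    · omega
    · have := Nat.lt_two_pow_self (n := t)
      rw [pow_succ] at hcard
      omega
  choose! b hb using hT₀
  obtain ⟨z, hz, hzi⟩ := hx.exists_linearIndependent_eqOn hV S x
  have hφ : ∀ i ∈ T₀, ∃ φ : V →ₗ[F] F, ∀ v, P i (b i) (Function.update z a v) = φ v :=
    fun i hi => hlin i (b i) z a (Finset.mem_inter.1 ((hb i hi).symm ▸ ha)).1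
  choose! φ hφ using hφ
  have hrest : ((insert a (S \ A))ᶜ : Finset ι).card + T₀.card < Module.finrank F V := by
    have h1 : (insert a (S \ A)).card = S.card - A.card + 1 := by
      rw [Finset.card_insert_of_notMem (by simp [ha]), Finset.card_sdiff_of_subset hAS]
    have h2 := Finset.card_add_card_compl (insert a (S \ A))
    omega
  obtain ⟨v, hv0, hv⟩ := exists_mem_forall_eq_zero_notMem_span z _ T₀ φ hrest
  have hind := (hzi.linearIndepOn (s := ((insert a (S \ A))ᶜ : Finset ι))).update_insert
    (a := a) (by simp) hv
  have hset : insert a (((insert a (S \ A))ᶜ : Finset ι) : Set ι) = ((S \ A)ᶜ : Finset ι) := by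
    ext j
    by_cases hj : j = a <;> simp [hj, ha]
  rw [hset] at hind
  have hdiff : (T \ T₀).card = T.card - T₀.card := Finset.card_sdiff_of_subset hT₀T
  obtain ⟨y, hy, hyi, hyT⟩ := ih (T \ T₀).card (by omega) (T \ T₀) (S \ A)
    (by
      have h1 : 2 ^ (T \ T₀).card ≤ 2 ^ t := Nat.pow_le_pow_right (by norm_num) (by omega)
      rw [Finset.card_sdiff_of_subset hAS]
      omega)
    (by
      intro i hi b
      rw [Finset.mem_sdiff] at hi
      by_contra hemp
      rw [Finset.not_nonempty_iff_eq_empty, ← Finset.inter_sdiff_assoc,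
        Finset.sdiff_eq_empty_iff_subset] at hemp
      exact hi.2 (Finset.mem_filter.2
        ⟨hi.1, b, Finset.eq_of_subset_of_card_le hemp (hmin i hi.1 b)⟩))
    _ hind rfl
  refine ⟨y, fun j hj => ?_, hyi, fun i hi => ?_⟩
  · rw [hy j (fun h => hj (Finset.mem_sdiff.1 h).1),
      Function.update_of_ne (ne_of_mem_of_not_mem haS hj).symm, hz j hj]
  · by_cases hi0 : i ∈ T₀
    · refine ⟨b i, ?_⟩
      rw [← hv0 i hi0, ← hφ i hi0]
      refine hdep i (b i) _ _ fun j hj => hy j fun hjS => ?_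
      rw [Finset.mem_sdiff] at hjS
      exact hjS.2 (hb i hi0 ▸ Finset.mem_inter.2 ⟨hj, hjS.1⟩)
    · exact hyT i (Finset.mem_sdiff.2 ⟨hi, hi0⟩)

theorem MultilinearMap.exists_linearMap_comp_update {F V ι : Type*} [Field F] [AddCommGroup V]
    [Module F V] [DecidableEq ι] {p : ι → Prop}
    (f : MultilinearMap F (fun _ : {j // p j} => V) F) (x : ι → V) (a : ι) (ha : p a) :
    ∃ φ : V →ₗ[F] F, ∀ v, f (fun j => Function.update x a v j.1) = φ v := by
  classical
  refine ⟨f.toLinearMap (fun j => x j.1) ⟨a, ha⟩, fun v => ?_⟩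
  rw [MultilinearMap.toLinearMap_apply]
  congr 1
  ext j
  by_cases hj : j = ⟨a, ha⟩
  · subst hj; simp
  · have : j.1 ≠ a := fun h => hj (Subtype.ext h)
    simp [hj, this]

theorem IsPartitionDecompOfDet.two_mul_le_two_pow {F : Type*} [Field F] {n r : ℕ}
    {I : Fin r → Finset (Fin n)}
    {Q : ∀ i, MultilinearMap F (fun _ : {j : Fin n // j ∈ I i} => (Fin n → F)) F}
    {R : ∀ i, MultilinearMap F (fun _ : {j : Fin n // j ∉ I i} => (Fin n → F)) F}
    (h : IsPartitionDecompOfDet F n r I Q R) : 2 * n ≤ 2 ^ r := by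
  by_contra! hlt
  obtain ⟨hI, hdet⟩ := h
  let P : Fin r → Bool → (Fin n → Fin n → F) → F := fun i b x =>
    bif b then Q i (fun j => x j.1) else R i (fun j => x j.1)
  obtain ⟨y, -, hyi, hy⟩ := exists_linearIndependent_forall_exists_eq_zero (F := F)
    (V := Fin n → F) (ι := Fin n) (by simp) (fun i b => bif b then I i else (I i)ᶜ)
    (by rintro i (_ | _) <;> simp) P
    (by
      rintro i (_ | _) x y hxy
      · exact congrArg (R i) (funext fun j => hxy j (Finset.mem_compl.2 j.2))
      · exact congrArg (Q i) (funext fun j => hxy j j.2))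
    (by
      rintro i (_ | _) x a ha
      · exact (R i).exists_linearMap_comp_update x a (Finset.mem_compl.1 ha)
      · exact (Q i).exists_linearMap_comp_update x a ha)
    Finset.univ Finset.univ (by simpa using hlt)
    (by
      rintro i - (_ | _)
      · simpa [Finset.nonempty_iff_ne_empty] using (hI i).2
      · simpa using (hI i).1)
    0 (by simp)
  have hzero : (Matrix.of y).det = 0 := by
    rw [hdet]
    refine Finset.sum_eq_zero fun i hi => ?_
    obtain ⟨_ | _, hb⟩ := hy i hi
    · exact mul_eq_zero_of_right _ hb
    · exact mul_eq_zero_of_left hb _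
  have hunit : IsUnit (Matrix.of y) := Matrix.linearIndependent_rows_iff_isUnit.1 hyi
  exact ((Matrix.isUnit_iff_isUnit_det _).1 hunit).ne_zero hzero

theorem prk_det_lower_bound {F : Type*} [Field F] (n : ℕ) (hn : 2 ≤ n) (r : ℕ)
    (I : Fin r → Finset (Fin n))
    (Q : ∀ i, MultilinearMap F (fun _ : {j : Fin n // j ∈ I i} => (Fin n → F)) F)
    (R : ∀ i, MultilinearMap F (fun _ : {j : Fin n // j ∉ I i} => (Fin n → F)) F)
    (hdecomp : IsPartitionDecompOfDet F n r I Q R) :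
    Real.logb 2 n + 1 ≤ (r : ℝ) := by
  have hpow : (n : ℝ) * 2 ≤ 2 ^ (r : ℝ) := by
    rw [Real.rpow_natCast, mul_comm]
    exact_mod_cast hdecomp.two_mul_le_two_pow
  have hn0 : (0 : ℝ) < n := by exact_mod_cast (by omega : 0 < n)
  rw [← Real.logb_self_eq_one (b := 2) (by norm_num), ← Real.logb_mul hn0.ne' two_ne_zero]
  exact (Real.logb_le_iff_le_rpow (by norm_num) (by positivity)).2 hpow
end

section
/- Let F be a field and let k, ℓ, n be integers with k ≥ 1 and k + ℓ ≤ n. Let Q : (Fⁿ)ᵏ → F^ℓ be a k-linear map (i.e., each of its ℓ coordinates is a multilinear form in k vector variables from Fⁿ). Then there exist linearly independent vectors v_1,...,v_k ∈ Fⁿ such that Q(v_1,...,v_k) = 0. -/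
theorem multilinear_common_independent_zero {F : Type*} [Field F]
    (k l n : ℕ) (hk : 1 ≤ k) (hkl : k + l ≤ n)
    (Q : MultilinearMap F (fun _ : Fin k => (Fin n → F)) (Fin l → F)) :
    ∃ v : Fin k → (Fin n → F), LinearIndependent F v ∧ Q v = 0 := by
  obtain ⟨m, rfl⟩ : ∃ m, k = m + 1 := ⟨k - 1, by omega⟩
  -- Fix independent vectors in all slots but the last one.
  obtain ⟨w, hw⟩ : ∃ w : Fin m → (Fin n → F), LinearIndependent F w :=
    ⟨_, (Pi.basisFun F (Fin n)).linearIndependent.comp (Fin.castLE (by omega : m ≤ n))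
      (Fin.castLE_injective _)⟩
  let f : (Fin n → F) →ₗ[F] (Fin l → F) := Q.curryRight w
  -- The kernel in the last slot is too large to lie in their span.
  have hlt : ¬ LinearMap.ker f ≤ Submodule.span F (Set.range w) := by
    intro hle
    have h1 := Submodule.finrank_mono hle
    have h2 := finrank_span_eq_card hw
    have h3 := f.finrank_range_add_finrank_ker
    have h4 := Submodule.finrank_le (LinearMap.range f)
    simp only [Module.finrank_fin_fun, Fintype.card_fin] at h2 h3 h4
    omega
  obtain ⟨x, hx, hxw⟩ := SetLike.not_le_iff_exists.mp hlt
  exact ⟨Fin.snoc w x, linearIndependent_finSnoc.mpr ⟨hw, hxw⟩, hx⟩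
end

section
/- For every field F and every 4×4 matrix A over F, det(A) = (Σ_J det(A_{{1,2},J}))·(Σ_J det(A_{{3,4},J})) − (Σ_J det(A_{{1,3},J}))·(Σ_J det(A_{{2,4},J})) + (Σ_J det(A_{{1,4},J}))·(Σ_J det(A_{{2,3},J})), where each sum ranges over all 2-element subsets J of {1,2,3,4}, and A_{I,J} denotes the 2×2 submatrix of A on the rows indexed by I and columns indexed by J (rows and columns taken in increasing order). -/
/-- `sum2x2Minors A i₁ i₂` is `Σ_J det(A_{{i₁,i₂},J})`, the sum over all 2-element
column subsets `J = {j₁ < j₂}` of the 2×2 minor of `A` on rows `i₁ < i₂` and columns `J`. -/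
def sum2x2Minors {F : Type*} [Field F] (A : Matrix (Fin 4) (Fin 4) F)
    (i₁ i₂ : Fin 4) : F :=
  ∑ j₁ : Fin 4, ∑ j₂ : Fin 4,
    if j₁ < j₂ then A i₁ j₁ * A i₂ j₂ - A i₁ j₂ * A i₂ j₁ else 0

theorem det4_quadratic_expansion {F : Type*} [Field F] (A : Matrix (Fin 4) (Fin 4) F) :
    A.det =
        sum2x2Minors A 0 1 * sum2x2Minors A 2 3
      - sum2x2Minors A 0 2 * sum2x2Minors A 1 3
      + sum2x2Minors A 0 3 * sum2x2Minors A 1 2 := by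
  simp [sum2x2Minors, Matrix.det_succ_row_zero, Fin.sum_univ_succ, Fin.succAbove]
  ring
end

section
/- For every field F, the partition rank of the determinant 4-linear form det_4 equals 3. That is: (a) there is a partition rank decomposition of det_4 of length 3; and (b) there is no partition rank decomposition of det_4 of length at most 2. -/
/-- The standard symplectic form on `F⁴`. -/
def symplecticForm (F : Type*) [Field F] (x y : Fin 4 → F) : F :=
  x 0 * y 1 - x 1 * y 0 + (x 2 * y 3 - x 3 * y 2)

/-- The determinant is the Pfaffian of the Gram matrix of the standard symplectic form. -/
theorem det_eq_pfaffian_symplecticForm {F : Type*} [Field F] (x : Fin 4 → Fin 4 → F) :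
    (Matrix.of x).det =
      symplecticForm F (x 0) (x 1) * symplecticForm F (x 2) (x 3)
        - symplecticForm F (x 0) (x 2) * symplecticForm F (x 1) (x 3)
        + symplecticForm F (x 0) (x 3) * symplecticForm F (x 1) (x 2) := by
  simp only [Matrix.det_succ_row_zero, Fin.sum_univ_succ, symplecticForm]
  simp [Fin.succAbove, Fin.lt_def]
  ring

theorem exists_multilinearMap_eq_symplecticForm {F : Type*} [Field F] (p : Fin 4 → Prop)
    (a b : Fin 4) (hab : a ≠ b) (hp : ∀ j, p j ↔ j = a ∨ j = b) (c : F) :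
    ∃ Q : MultilinearMap F (fun _ : {j : Fin 4 // p j} => (Fin 4 → F)) F,
      ∀ x : Fin 4 → Fin 4 → F, Q (fun j => x j.1) = c * symplecticForm F (x a) (x b) := by
  have ha : p a := (hp a).2 (Or.inl rfl)
  have hb : p b := (hp b).2 (Or.inr rfl)
  refine ⟨⟨fun x => c * symplecticForm F (x ⟨a, ha⟩) (x ⟨b, hb⟩), ?_, ?_⟩, fun x => rfl⟩
  · rintro _ m ⟨j, hj⟩ u v
    rcases (hp j).1 hj with rfl | rfl
    · simp [hab.symm, symplecticForm]
      ring
    · simp [hab, symplecticForm]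
      ring
  · rintro _ m ⟨j, hj⟩ t u
    rcases (hp j).1 hj with rfl | rfl
    · simp [hab.symm, symplecticForm]
      ring
    · simp [hab, symplecticForm]
      ring

theorem exists_isPartitionDecompOfDet_four_three (F : Type*) [Field F] :
    ∃ (I : Fin 3 → Finset (Fin 4))
      (Q : ∀ i, MultilinearMap F (fun _ : {j : Fin 4 // j ∈ I i} => (Fin 4 → F)) F)
      (R : ∀ i, MultilinearMap F (fun _ : {j : Fin 4 // j ∉ I i} => (Fin 4 → F)) F),
      IsPartitionDecompOfDet F 4 3 I Q R := by
  let I : Fin 3 → Finset (Fin 4) := fun i => {0, i.succ}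
  let b : Fin 3 → Fin 4 := ![2, 1, 1]
  let c : Fin 3 → Fin 4 := ![3, 3, 2]
  let s : Fin 3 → F := ![1, -1, 1]
  have hQ (i : Fin 3) := exists_multilinearMap_eq_symplecticForm (F := F) (· ∈ I i) 0 i.succ
    (Fin.succ_ne_zero i).symm (by revert i; decide) 1
  have hR (i : Fin 3) := exists_multilinearMap_eq_symplecticForm (F := F) (· ∉ I i) (b i) (c i)
    (by revert i; decide) (by revert i; decide) (s i)
  choose Q hQ using hQ
  choose R hR using hR
  refine ⟨I, Q, R, by decide, fun x => ?_⟩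
  simp only [hQ, hR, det_eq_pfaffian_symplecticForm, Fin.sum_univ_three]
  simp [b, c, s]
  ring

/-- Freezing all variables but one turns a multilinear form into a linear form. -/
theorem exists_linearMap_of_multilinearMap {F ι V : Type*} [Field F] [AddCommGroup V] [Module F V]
    {p : ι → Prop} (Q : MultilinearMap F (fun _ : {j : ι // p j} => V) F)
    {m : ι} (hm : p m) (v : V) :
    ∃ μ : V →ₗ[F] F, ∀ x : ι → V, (∀ j, p j → j ≠ m → x j = v) →
      Q (fun j => x j.1) = μ (x m) := by
  classical
  refine ⟨Q.toLinearMap (fun _ => v) ⟨m, hm⟩, fun x hx => ?_⟩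
  rw [MultilinearMap.toLinearMap_apply]
  congr 1
  funext ⟨j, hj⟩
  by_cases h : j = m
  · subst h; simp
  · simp [h, hx j hj h]

/-- A function of `n + 1` vectors is killed by two linear conditions if it vanishes as soon as
the first vector lies in the kernel of some linear form and some other vector lies in the kernel
of a linear form depending on the first vector. -/
def KilledByLinearForms (F : Type*) {V : Type*} [Field F] [AddCommGroup V] [Module F V] {n : ℕ}
    (T : (Fin (n + 1) → V) → F) : Prop :=
  ∃ (lam : V →ₗ[F] F) (j : Fin (n + 1)), j ≠ 0 ∧ ∀ v, lam v = 0 →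
    ∃ μ : V →ₗ[F] F, ∀ x, x 0 = v → μ (x j) = 0 → T x = 0

theorem killedByLinearForms_zero {F V : Type*} [Field F] [AddCommGroup V] [Module F V] :
    KilledByLinearForms F (fun _ : Fin (3 + 1) → V => (0 : F)) :=
  ⟨0, 1, by decide, fun _ _ => ⟨0, fun _ _ _ => rfl⟩⟩

theorem killedByLinearForms_of_singleton {F V : Type*} [Field F] [AddCommGroup V] [Module F V]
    {p : Fin (3 + 1) → Prop} (Q : MultilinearMap F (fun _ : {j // p j} => V) F)
    (hp : ∀ j, p j ↔ j = 0) :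
    KilledByLinearForms F (fun x => Q (fun j => x j.1)) := by
  obtain ⟨lam, hlam⟩ := exists_linearMap_of_multilinearMap Q ((hp 0).2 rfl) 0
  refine ⟨lam, 1, by decide, fun v hv => ⟨0, fun x hx _ => ?_⟩⟩
  refine (hlam x fun j hj hj0 => absurd ((hp j).1 hj) hj0).trans ?_
  rw [hx, hv]

theorem killedByLinearForms_of_subset_pair {F V : Type*} [Field F] [AddCommGroup V] [Module F V]
    {n : ℕ} {p : Fin (n + 1) → Prop} (Q : MultilinearMap F (fun _ : {j // p j} => V) F)
    {m : Fin (n + 1)} (hm0 : m ≠ 0) (hm : p m) (hp : ∀ j, p j → j = m ∨ j = 0) :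
    KilledByLinearForms F (fun x => Q (fun j => x j.1)) := by
  refine ⟨0, m, hm0, fun v _ => ?_⟩
  obtain ⟨μ, hμ⟩ := exists_linearMap_of_multilinearMap Q hm v
  refine ⟨μ, fun x hx h => ?_⟩
  exact (hμ x fun j hj hjm => (hp j hj).resolve_left hjm ▸ hx).trans h

theorem KilledByLinearForms.of_eq_zero_imp {F V : Type*} [Field F] [AddCommGroup V] [Module F V]
    {n : ℕ} {S T : (Fin (n + 1) → V) → F} (hS : KilledByLinearForms F S)
    (h : ∀ x, S x = 0 → T x = 0) : KilledByLinearForms F T := by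
  obtain ⟨lam, j, hj, hlam⟩ := hS
  refine ⟨lam, j, hj, fun v hv => ?_⟩
  obtain ⟨μ, hμ⟩ := hlam v hv
  exact ⟨μ, fun x hx hxj => h x (hμ x hx hxj)⟩

theorem killedByLinearForms_mul {F V : Type*} [Field F] [AddCommGroup V] [Module F V]
    {I : Finset (Fin 4)} (hI : I.Nonempty) (hI' : I ≠ Finset.univ)
    (Q : MultilinearMap F (fun _ : {j : Fin 4 // j ∈ I} => V) F)
    (R : MultilinearMap F (fun _ : {j : Fin 4 // j ∉ I} => V) F) :
    KilledByLinearForms F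
      (fun x : Fin (3 + 1) → V => Q (fun j => x j.1) * R (fun j => x j.1)) := by
  have key : (∀ j, j ∈ I ↔ j = 0) ∨ (∀ j, j ∉ I ↔ j = 0) ∨
      (∃ m, m ≠ 0 ∧ m ∈ I ∧ ∀ j, j ∈ I → j = m ∨ j = 0) ∨
      (∃ m, m ≠ 0 ∧ m ∉ I ∧ ∀ j, j ∉ I → j = m ∨ j = 0) := by
    clear Q R
    revert I
    decide
  rcases key with h | h | ⟨m, hm0, hm, h⟩ | ⟨m, hm0, hm, h⟩
  · exact (killedByLinearForms_of_singleton Q h).of_eq_zero_imp fun x hx => by simp_all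
  · exact (killedByLinearForms_of_singleton R h).of_eq_zero_imp fun x hx => by simp_all
  · exact (killedByLinearForms_of_subset_pair Q hm0 hm h).of_eq_zero_imp fun x hx => by simp_all
  · exact (killedByLinearForms_of_subset_pair R hm0 hm h).of_eq_zero_imp fun x hx => by simp_all

/-- Greedy extension of a nonzero vector to a linearly independent family whose further members
lie in prescribed subspaces that are large enough. -/
theorem exists_linearIndependent_mem {F V : Type*} [Field F] [AddCommGroup V] [Module F V]
    [FiniteDimensional F V] {v : V} (hv : v ≠ 0) {n : ℕ} (K : Fin n → Submodule F V)
    (hK : ∀ k : Fin n, (k : ℕ) + 1 < Module.finrank F (K k)) :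
    ∃ x : Fin (n + 1) → V, LinearIndependent F x ∧ x 0 = v ∧ ∀ k, x k.succ ∈ K k := by
  induction n with
  | zero => exact ⟨fun _ => v, LinearIndependent.of_subsingleton (ι := Fin 1) 0 hv, rfl, fun k => k.elim0⟩
  | succ n ih =>
    obtain ⟨x, hx, hx0, hxK⟩ := ih (fun k => K k.castSucc) fun k => hK k.castSucc
    have hspan : Module.finrank F (Submodule.span F (Set.range x)) = n + 1 := by
      simpa using finrank_span_eq_card hx
    have hnot : ¬ K (Fin.last n) ≤ Submodule.span F (Set.range x) := fun hle => by
      have h1 := Submodule.finrank_mono hle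
      have h2 := hK (Fin.last n)
      rw [Fin.val_last] at h2
      omega
    obtain ⟨w, hw, hws⟩ := SetLike.not_le_iff_exists.1 hnot
    refine ⟨Fin.snoc x w, linearIndependent_finSnoc.2 ⟨hx, hws⟩, ?_, fun k => ?_⟩
    · rw [← Fin.castSucc_zero, Fin.snoc_castSucc, hx0]
    · refine Fin.lastCases ?_ (fun k => ?_) k
      · simpa only [Fin.succ_last, Fin.snoc_last] using hw
      · simpa only [Fin.succ_castSucc, Fin.snoc_castSucc] using hxK k

theorem finrank_le_finrank_inf_ker_add_one {F V : Type*} [Field F] [AddCommGroup V] [Module F V]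
    [FiniteDimensional F V] (W : Submodule F V) (μ : V →ₗ[F] F) :
    Module.finrank F W ≤ Module.finrank F (W ⊓ LinearMap.ker μ : Submodule F V) + 1 := by
  have h1 := Submodule.finrank_sup_add_finrank_inf_eq W (LinearMap.ker μ)
  have h2 := LinearMap.finrank_range_add_finrank_ker μ
  have h3 := Submodule.finrank_le (LinearMap.range μ)
  have h4 := Submodule.finrank_le (W ⊔ LinearMap.ker μ)
  rw [Module.finrank_self] at h3
  omega

theorem KilledByLinearForms.exists_linearIndependent {F V : Type*} [Field F] [AddCommGroup V]
    [Module F V] [FiniteDimensional F V] (hV : Module.finrank F V = 4)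
    {S T : (Fin (3 + 1) → V) → F}
    (hS : KilledByLinearForms F S) (hT : KilledByLinearForms F T) :
    ∃ x, LinearIndependent F x ∧ S x = 0 ∧ T x = 0 := by
  obtain ⟨lam, i, hi, hlam⟩ := hS
  obtain ⟨lam', j, hj, hlam'⟩ := hT
  have htop : Module.finrank F (⊤ : Submodule F V) = 4 := by rw [finrank_top, hV]
  have hker (μ : V →ₗ[F] F) : 3 ≤ Module.finrank F (LinearMap.ker μ) := by
    have h := finrank_le_finrank_inf_ker_add_one ⊤ μ
    rw [top_inf_eq] at h
    omega
  have hker₂ (μ μ' : V →ₗ[F] F) : 2 ≤ Module.finrank F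
      (LinearMap.ker μ ⊓ LinearMap.ker μ' : Submodule F V) := by
    have h := finrank_le_finrank_inf_ker_add_one (LinearMap.ker μ) μ'
    have h' := hker μ
    omega
  obtain ⟨v, hv, hv0⟩ := Submodule.exists_mem_ne_zero_of_ne_bot
    (p := LinearMap.ker lam ⊓ LinearMap.ker lam') fun h => by
      have h' := hker₂ lam lam'
      rw [h, finrank_bot] at h'
      omega
  obtain ⟨μ, hμ⟩ := hlam v hv.1
  obtain ⟨μ', hμ'⟩ := hlam' v hv.2
  have ht₂ : 3 < Module.finrank F (⊤ : Submodule F V) := by omega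
  have ht₁ : 2 < Module.finrank F (⊤ : Submodule F V) := by omega
  have h₂ := hker₂ μ μ'
  have h₁ := hker μ
  have h₁' := hker μ'
  by_cases hij : i = j
  · subst hij
    obtain ⟨σ, h0, h1⟩ : ∃ σ : Equiv.Perm (Fin 4), σ 0 = 0 ∧ σ i = 1 := by
      clear * - hi; revert i; decide
    obtain ⟨x, hx, hx0, hxK⟩ := exists_linearIndependent_mem hv0
      ![LinearMap.ker μ ⊓ LinearMap.ker μ', ⊤, ⊤] (by
        intro k
        fin_cases k
        exacts [h₂, ht₁, ht₂])
    have hx1 := hxK 0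
    refine ⟨x ∘ σ, hx.comp σ σ.injective, hμ _ ?_ ?_, hμ' _ ?_ ?_⟩
    · simpa [h0] using hx0
    · simpa [h1] using hx1.1
    · simpa [h0] using hx0
    · simpa [h1] using hx1.2
  · obtain ⟨σ, h0, h1, h2⟩ : ∃ σ : Equiv.Perm (Fin 4), σ 0 = 0 ∧ σ i = 1 ∧ σ j = 2 := by
      clear * - hi hj hij; revert i j; decide
    obtain ⟨x, hx, hx0, hxK⟩ := exists_linearIndependent_mem hv0
      ![LinearMap.ker μ, LinearMap.ker μ', ⊤] (by
        intro k
        fin_cases k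
        exacts [(Nat.le_of_succ_le h₁ :), h₁', ht₂])
    have hx1 := hxK 0
    have hx2 := hxK 1
    refine ⟨x ∘ σ, hx.comp σ σ.injective, hμ _ ?_ ?_, hμ' _ ?_ ?_⟩
    · simpa [h0] using hx0
    · simpa [h1] using hx1
    · simpa [h0] using hx0
    · simpa [h2] using hx2

theorem det_ne_add_of_killedByLinearForms {F : Type*} [Field F]
    {S T : (Fin (3 + 1) → Fin 4 → F) → F}
    (hS : KilledByLinearForms F S) (hT : KilledByLinearForms F T) :
    ¬ ∀ x, (Matrix.of x).det = S x + T x := by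
  intro h
  obtain ⟨x, hx, hSx, hTx⟩ := hS.exists_linearIndependent (by simp) hT
  have hunit : IsUnit (Matrix.of x : Matrix (Fin 4) (Fin 4) F) :=
    Matrix.linearIndependent_rows_iff_isUnit.1 hx
  refine ((Matrix.isUnit_iff_isUnit_det _).1 hunit).ne_zero ?_
  rw [h, hSx, hTx, add_zero]

theorem prk_det4_eq_three (F : Type*) [Field F] :
    (∃ (I : Fin 3 → Finset (Fin 4))
        (Q : ∀ i, MultilinearMap F (fun _ : {j : Fin 4 // j ∈ I i} => (Fin 4 → F)) F)
        (R : ∀ i, MultilinearMap F (fun _ : {j : Fin 4 // j ∉ I i} => (Fin 4 → F)) F),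
        IsPartitionDecompOfDet F 4 3 I Q R) ∧
      ∀ (r : ℕ), r ≤ 2 →
        ∀ (I : Fin r → Finset (Fin 4))
          (Q : ∀ i, MultilinearMap F (fun _ : {j : Fin 4 // j ∈ I i} => (Fin 4 → F)) F)
          (R : ∀ i, MultilinearMap F (fun _ : {j : Fin 4 // j ∉ I i} => (Fin 4 → F)) F),
          ¬ IsPartitionDecompOfDet F 4 r I Q R := by
  refine ⟨exists_isPartitionDecompOfDet_four_three F, ?_⟩
  rintro r hr I Q R ⟨hI, h⟩
  have hkill i := killedByLinearForms_mul (hI i).1 (hI i).2 (Q i) (R i)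
  interval_cases r
  · exact det_ne_add_of_killedByLinearForms killedByLinearForms_zero killedByLinearForms_zero
      fun x => (h x).trans (by simp)
  · exact det_ne_add_of_killedByLinearForms (hkill 0) killedByLinearForms_zero
      fun x => by simpa using h x
  · exact det_ne_add_of_killedByLinearForms (hkill 0) (hkill 1)
      fun x => by simpa only [Fin.sum_univ_two] using h x
end

section
/- Let F be a field and let T : M_4(F) → M_4(F) be a linear map on the space of 4×4 matrices over F satisfying det(T(X)) = det(X) for every X ∈ M_4(F). Then T is bijective. -/
/-- A nonzero matrix over a field can turn a singular matrix into a nonsingular one by addition. -/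
theorem Matrix.exists_det_eq_zero_det_add_ne_zero {n F : Type*} [Fintype n] [DecidableEq n]
    [Field F] {A : Matrix n n F} (hA : A ≠ 0) :
    ∃ X : Matrix n n F, X.det = 0 ∧ (X + A).det ≠ 0 := by
  obtain ⟨i, j, hij⟩ : ∃ i j, A i j ≠ 0 := by
    by_contra! h
    exact hA (Matrix.ext h)
  refine ⟨((1 : Matrix n n F).updateCol i (A.col j)).submatrix id (Equiv.swap i j) - A, ?_, ?_⟩
  · exact Matrix.det_eq_zero_of_column_eq_zero j fun k => by simp
  · rw [sub_add_cancel, Matrix.det_permute', ← Matrix.cramer_apply, Matrix.cramer_one]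
    exact mul_ne_zero ((Equiv.Perm.sign _).isUnit.map (Int.castRingHom F)).ne_zero hij

theorem det_preserving_linear_map_bijective {F : Type*} [Field F]
    (T : Matrix (Fin 4) (Fin 4) F →ₗ[F] Matrix (Fin 4) (Fin 4) F)
    (hT : ∀ X : Matrix (Fin 4) (Fin 4) F, (T X).det = X.det) :
    Function.Bijective T := by
  have hinj : Function.Injective T := by
    refine (injective_iff_map_eq_zero T).2 fun A hTA => ?_
    by_contra hA
    obtain ⟨X, hX, hXA⟩ := Matrix.exists_det_eq_zero_det_add_ne_zero hA
    exact hXA (by rw [← hT, map_add, hTA, add_zero, hT, hX])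
  exact ⟨hinj, LinearMap.injective_iff_surjective.1 hinj⟩
end

section
/- Let q be a prime power, F_q the finite field with q elements, and let 1 ≤ m ≤ n. Let P denote the probability that a uniformly random m×n matrix over F_q has rank strictly less than m, i.e., P = |{A ∈ F_q^{m×n} : rank(A) < m}| / q^{mn}. Then q^{−(n−m+1)} ≤ P < (1 + 1/(q−1))·q^{−(n−m+1)}. -/
/-- Bernoulli-type (Weierstrass product) inequality. -/
theorem one_sub_sum_range_le_prod_range {f : ℕ → ℝ} (m : ℕ)
    (h0 : ∀ i < m, 0 ≤ f i) (h1 : ∀ i < m, f i ≤ 1) :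
    1 - ∑ i ∈ Finset.range m, f i ≤ ∏ i ∈ Finset.range m, (1 - f i) := by
  induction m with
  | zero => simp
  | succ k ih =>
    have ih := ih (fun i hi => h0 i (by omega)) (fun i hi => h1 i (by omega))
    have hle : ∏ i ∈ Finset.range k, (1 - f i) ≤ 1 :=
      Finset.prod_le_one
        (fun i hi => sub_nonneg.2 (h1 i (by grind)))
        (fun i hi => sub_le_self _ (h0 i (by grind)))
    rw [Finset.sum_range_succ, Finset.prod_range_succ]
    nlinarith [h0 k (by omega)]

theorem Matrix.rank_lt_iff_not_linearIndependent_row {F : Type*} [Field F] {m n : ℕ}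
    (A : Matrix (Fin m) (Fin n) F) :
    A.rank < m ↔ ¬ LinearIndependent F A.row := by
  have h := A.rank_le_height
  rw [linearIndependent_iff_card_eq_finrank_span, Fintype.card_fin, Set.finrank,
    ← A.rank_eq_finrank_span_row]
  omega

/-- The number of rank-deficient matrices complements the number of linearly independent
families of rows. -/
theorem card_rank_lt_div_eq {F : Type*} [Field F] [Fintype F] {m n : ℕ} (hmn : m ≤ n) :
    (Nat.card {A : Matrix (Fin m) (Fin n) F // A.rank < m} : ℝ) /
        (Fintype.card F : ℝ) ^ (m * n) =
      1 - ∏ i ∈ Finset.range m,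
        (1 - (Fintype.card F : ℝ) ^ i / (Fintype.card F : ℝ) ^ n) := by
  classical
  have hq : (Fintype.card F : ℝ) ≠ 0 := by simp
  have hindep : (Nat.card {s : Fin m → Fin n → F // LinearIndependent F s} : ℝ) =
      (Fintype.card F : ℝ) ^ (m * n) * ∏ i ∈ Finset.range m,
        (1 - (Fintype.card F : ℝ) ^ i / (Fintype.card F : ℝ) ^ n) := by
    rw [card_linearIndependent (by simpa using hmn), Module.finrank_fin_fun,
      Fin.prod_univ_eq_prod_range (fun i => Fintype.card F ^ n - Fintype.card F ^ i) m,
      mul_comm m n, pow_mul, Nat.cast_prod]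
    conv_rhs => rw [← Finset.card_range m, ← Finset.prod_const, Finset.card_range,
      ← Finset.prod_mul_distrib]
    refine Finset.prod_congr rfl fun i hi => ?_
    rw [Nat.cast_sub (Nat.pow_le_pow_right Fintype.card_pos
      (by grind))]
    push_cast
    field_simp
  have hcompl : Nat.card {A : Matrix (Fin m) (Fin n) F // A.rank < m} +
      Nat.card {s : Fin m → Fin n → F // LinearIndependent F s} =
      Fintype.card F ^ (m * n) := by
    rw [Nat.card_congr (Equiv.subtypeEquivRight
      fun A => A.rank_lt_iff_not_linearIndependent_row), add_comm, ← Nat.card_sum]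
    refine (Nat.card_congr
      (Equiv.sumCompl fun s : Fin m → Fin n → F => LinearIndependent F s)).trans ?_
    simp [← pow_mul, mul_comm]
  rw [div_eq_iff (pow_ne_zero _ hq), sub_mul, one_mul, mul_comm (∏ _ ∈ _, _), ← hindep,
    eq_sub_iff_add_eq]
  exact_mod_cast hcompl

theorem prob_rank_deficient {F : Type*} [Field F] [Fintype F] (m n : ℕ)
    (hm : 1 ≤ m) (hmn : m ≤ n) :
    ((Fintype.card F : ℝ) ^ (n - m + 1))⁻¹ ≤
        (Nat.card {A : Matrix (Fin m) (Fin n) F // A.rank < m} : ℝ) /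
          (Fintype.card F : ℝ) ^ (m * n) ∧
      (Nat.card {A : Matrix (Fin m) (Fin n) F // A.rank < m} : ℝ) /
          (Fintype.card F : ℝ) ^ (m * n) <
        (1 + 1 / ((Fintype.card F : ℝ) - 1)) * ((Fintype.card F : ℝ) ^ (n - m + 1))⁻¹ := by
  rw [card_rank_lt_div_eq hmn]
  have hq : (1 : ℝ) < Fintype.card F := by exact_mod_cast Fintype.one_lt_card
  generalize (Fintype.card F : ℝ) = q at hq
  have hq0 : 0 < q := by linarith
  have hf0 : ∀ i, 0 ≤ q ^ i / q ^ n := fun i => by positivity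
  have hf1 : ∀ i < m, q ^ i / q ^ n ≤ 1 := fun i hi =>
    div_le_one_of_le₀ (pow_le_pow_right₀ hq.le (by omega)) (by positivity)
  obtain ⟨k, rfl⟩ : ∃ k, m = k + 1 := ⟨m - 1, by omega⟩
  have hlast : (q ^ (n - (k + 1) + 1))⁻¹ = q ^ k / q ^ n := by
    obtain ⟨d, rfl⟩ := Nat.exists_eq_add_of_le hmn
    rw [Nat.add_sub_cancel_left, show k + 1 + d = k + (d + 1) by omega, pow_add q k]
    field_simp
  rw [hlast]
  constructor
  · rw [Finset.prod_range_succ]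
    have hle : ∏ i ∈ Finset.range k, (1 - q ^ i / q ^ n) ≤ 1 :=
      Finset.prod_le_one
        (fun i hi => sub_nonneg.2 (hf1 i (by grind)))
        (fun i _ => sub_le_self _ (hf0 i))
    nlinarith [hf1 k (by omega)]
  · have hprod := one_sub_sum_range_le_prod_range (k + 1) (fun i _ => hf0 i) hf1
    have hsum : ∑ i ∈ Finset.range (k + 1), q ^ i / q ^ n <
        (1 + 1 / (q - 1)) * (q ^ k / q ^ n) := by
      have hq1 : 0 < q - 1 := by linarith
      rw [← Finset.sum_div, geom_sum_eq hq.ne', ← mul_div_assoc]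
      gcongr
      rw [show (1 + 1 / (q - 1)) * q ^ k = q ^ (k + 1) / (q - 1) by field_simp; ring]
      gcongr
      linarith
    linarith
end

section
/- Let q be a prime power, F_q the finite field with q elements, n ≥ 2, and y ∈ F_q with y ≠ 0. Define bias(det_n) = |{A ∈ M_n(F_q) : det(A) = 0}|/q^{n²} − |{A ∈ M_n(F_q) : det(A) = y}|/q^{n²}. Then q^{−2} ≤ bias(det_n) < q^{−1}; equivalently, ⌈−log_q(bias(det_n))⌉ = 2, i.e., the ceiling of the analytic rank of det_n equals 2. -/
/-- The bias of the determinant of `n × n` matrices over a finite field `F`: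
`Pr[det = 0] − Pr[det = y]` for a fixed nonzero `y`. -/
noncomputable def detBias (F : Type*) [Field F] [Fintype F] (n : ℕ) (y : F) : ℝ :=
  (Nat.card {A : Matrix (Fin n) (Fin n) F // A.det = 0} : ℝ) /
      (Fintype.card F : ℝ) ^ (n ^ 2) -
    (Nat.card {A : Matrix (Fin n) (Fin n) F // A.det = y} : ℝ) /
      (Fintype.card F : ℝ) ^ (n ^ 2)

namespace Matrix

variable {F : Type*} [Field F] {m : Type*} [Fintype m] [DecidableEq m]

/-- Scaling one row by `z / y` takes matrices of determinant `y` to matrices of determinant `z`. -/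
theorem card_det_eq_le [Finite F] (i : m) {y z : F} (hy : y ≠ 0) (hz : z ≠ 0) :
    Nat.card {A : Matrix m m F // A.det = y} ≤ Nat.card {A : Matrix m m F // A.det = z} := by
  have hdet : (diagonal (Function.update (1 : m → F) i (z / y))).det = z / y := by
    simp [det_diagonal, Finset.prod_update_of_mem]
  refine Nat.card_le_card_of_injective
    (fun A ↦ ⟨diagonal (Function.update (1 : m → F) i (z / y)) * A.1, ?_⟩) ?_
  · rw [det_mul, hdet, A.2, div_mul_cancel₀ _ hy]
  · intro A B h
    have hu : IsUnit (diagonal (Function.update (1 : m → F) i (z / y))) := by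
      rw [isUnit_iff_isUnit_det, hdet]
      exact (div_ne_zero hz hy).isUnit
    exact Subtype.ext (hu.mul_left_cancel (congrArg Subtype.val h))

theorem card_det_eq [Finite F] (i : m) {y z : F} (hy : y ≠ 0) (hz : z ≠ 0) :
    Nat.card {A : Matrix m m F // A.det = y} = Nat.card {A : Matrix m m F // A.det = z} :=
  (card_det_eq_le i hy hz).antisymm (card_det_eq_le i hz hy)

theorem card_GL_eq_card_det_ne_zero :
    Nat.card (GL m F) = Nat.card {A : Matrix m m F // A.det ≠ 0} := by
  refine Nat.card_congr (Equiv.ofBijective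
    (fun g ↦ ⟨g.1, ((isUnit_iff_isUnit_det _).1 g.isUnit).ne_zero⟩) ⟨?_, ?_⟩)
  · intro g h e
    exact Units.ext (congrArg Subtype.val e)
  · rintro ⟨A, hA⟩
    obtain ⟨g, hg⟩ := (isUnit_iff_isUnit_det A).2 hA.isUnit
    exact ⟨g, Subtype.ext hg⟩

theorem card_det_zero_add_card_GL [Finite F] :
    Nat.card {A : Matrix m m F // A.det = 0} + Nat.card (GL m F) = Nat.card (Matrix m m F) := by
  classical
  rw [card_GL_eq_card_det_ne_zero, ← Nat.card_sum]
  exact Nat.card_congr (Equiv.sumCompl fun A : Matrix m m F ↦ A.det = 0)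

theorem card_units_mul_card_det_eq [Finite F] (i : m) {y : F} (hy : y ≠ 0) :
    Nat.card Fˣ * Nat.card {A : Matrix m m F // A.det = y} = Nat.card (GL m F) := by
  have := Fintype.ofFinite Fˣ
  rw [card_GL_eq_card_det_ne_zero, ← Nat.card_congr (Equiv.sigmaFiberEquiv
    fun A : {A : Matrix m m F // A.det ≠ 0} ↦ Units.mk0 A.1.det A.2), Nat.card_sigma]
  have h (u : Fˣ) : Nat.card {A : {A : Matrix m m F // A.det ≠ 0} // Units.mk0 A.1.det A.2 = u} =
      Nat.card {A : Matrix m m F // A.det = y} := by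
    rw [card_det_eq i hy u.ne_zero]
    exact Nat.card_congr
      { toFun A := ⟨A.1.1, congrArg Units.val A.2⟩
        invFun A := ⟨⟨A.1, A.2.trans_ne u.ne_zero⟩, Units.ext A.2⟩ }
  rw [Finset.sum_congr rfl fun u _ ↦ h u, Finset.sum_const, Finset.card_univ, smul_eq_mul,
    Nat.card_eq_fintype_card (α := Fˣ)]

theorem card_GL_div_card [Fintype F] (n : ℕ) :
    (Nat.card (GL (Fin n) F) : ℝ) / (Fintype.card F : ℝ) ^ (n ^ 2) =
      ∏ i ∈ Finset.range n, (1 - ((Fintype.card F : ℝ)⁻¹) ^ (i + 1)) := by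
  have hq : (Fintype.card F : ℝ) ≠ 0 := by simp
  rw [card_GL_field, Nat.cast_prod, ← Finset.prod_range_reflect, sq, pow_mul,
    Fin.prod_univ_eq_prod_range (fun i ↦ ((Fintype.card F ^ n - Fintype.card F ^ i : ℕ) : ℝ)) n]
  have hc : ((Fintype.card F : ℝ) ^ n) ^ n = ∏ i ∈ Finset.range n, (Fintype.card F : ℝ) ^ n := by
    simp
  rw [hc, ← Finset.prod_div_distrib]
  refine Finset.prod_congr rfl fun i hi ↦ ?_
  have hin := Finset.mem_range.1 hi
  rw [Nat.cast_sub (Nat.pow_le_pow_right Fintype.card_pos hin.le), show n - 1 - i + 1 = n - i by lia]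
  push_cast
  rw [sub_div, div_self (pow_ne_zero _ hq), inv_pow, ← pow_sub_mul_pow _ hin.le]
  field_simp

end Matrix

theorem one_sub_add_pow_le_prod_one_sub_pow {x : ℝ} (hx : 0 < x) (hx2 : x ≤ 1 / 2) (k : ℕ) :
    1 - x + x ^ (k + 1) ≤ ∏ i ∈ Finset.range k, (1 - x ^ (i + 2)) := by
  induction k with
  | zero => simp
  | succ k ih =>
    rw [Finset.prod_range_succ]
    have hp : 0 < x ^ k := pow_pos hx k
    have hp1 : x ^ k ≤ 1 := pow_le_one₀ hx.le (by linarith)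
    have h1 : 0 ≤ 1 - x ^ (k + 2) := sub_nonneg.2 (pow_le_one₀ hx.le (by linarith))
    refine le_trans ?_ (mul_le_mul_of_nonneg_right ih h1)
    have h2 : 0 ≤ 1 - x * (2 - x + x ^ k * x) := by
      nlinarith [mul_le_mul_of_nonneg_right hp1 (mul_pos hx hx).le]
    have h3 := mul_nonneg (mul_pos hp hx).le h2
    linear_combination h3

theorem prod_one_sub_pow_le {x : ℝ} (hx : 0 < x) (hx1 : x ≤ 1) (k : ℕ) :
    ∏ i ∈ Finset.range (k + 1), (1 - x ^ (i + 2)) ≤ 1 - x ^ 2 := by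
  have h (i : ℕ) : x ^ (i + 2) ≤ 1 := pow_le_one₀ hx.le hx1
  rw [Finset.prod_range_succ']
  refine mul_le_of_le_one_left (sub_nonneg.2 (h 0)) (Finset.prod_le_one ?_ ?_)
  · exact fun i _ ↦ sub_nonneg.2 (h (i + 1))
  · exact fun i _ ↦ sub_le_self _ (by positivity)

theorem detBias_eq {F : Type*} [Field F] [Fintype F] (k : ℕ) {y : F} (hy : y ≠ 0) :
    detBias F (k + 1) y =
      1 - ∏ i ∈ Finset.range k, (1 - ((Fintype.card F : ℝ)⁻¹) ^ (i + 2)) := by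
  have hq : 1 < (Fintype.card F : ℝ) := by exact_mod_cast Fintype.one_lt_card
  have h0 : (Nat.card {A : Matrix (Fin (k + 1)) (Fin (k + 1)) F // A.det = 0} : ℝ) +
      Nat.card (GL (Fin (k + 1)) F) = (Fintype.card F : ℝ) ^ ((k + 1) ^ 2) := by
    rw [← Nat.cast_add, Matrix.card_det_zero_add_card_GL]
    simp [Nat.card_eq_fintype_card, Matrix, ← pow_mul, sq]
  have h1 : ((Fintype.card F : ℝ) - 1) *
      Nat.card {A : Matrix (Fin (k + 1)) (Fin (k + 1)) F // A.det = y} =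
      Nat.card (GL (Fin (k + 1)) F) := by
    rw [← Matrix.card_units_mul_card_det_eq 0 hy, Nat.card_units, Nat.cast_mul,
      Nat.cast_sub Nat.card_pos, Nat.card_eq_fintype_card (α := F), Nat.cast_one]
  have h2 := Matrix.card_GL_div_card (F := F) (k + 1)
  rw [Finset.prod_range_succ'] at h2
  simp only [zero_add, pow_one, add_assoc, one_add_one_eq_two] at h2
  set q := (Fintype.card F : ℝ)
  set P := ∏ i ∈ Finset.range k, (1 - q⁻¹ ^ (i + 2))
  have hQ : 0 < q ^ ((k + 1) ^ 2) := by positivity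
  have hq1 : q - 1 ≠ 0 := by linarith
  rw [div_eq_iff hQ.ne'] at h2
  rw [detBias, ← sub_div, div_eq_iff hQ.ne', eq_sub_of_add_eq h0]
  rw [mul_comm, ← eq_div_iff hq1] at h1
  rw [h1, h2]
  field_simp
  ring

theorem bias_det_bounds {F : Type*} [Field F] [Fintype F] (n : ℕ) (hn : 2 ≤ n)
    (y : F) (hy : y ≠ 0) :
    (((Fintype.card F : ℝ) ^ 2)⁻¹ ≤ detBias F n y ∧
        detBias F n y < ((Fintype.card F : ℝ))⁻¹) ∧
      ⌈-Real.logb (Fintype.card F) (detBias F n y)⌉ = 2 := by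
  obtain ⟨k, rfl⟩ := Nat.exists_eq_add_of_le' hn
  have hq : (2 : ℝ) ≤ Fintype.card F := by exact_mod_cast Fintype.one_lt_card (α := F)
  have hx : 0 < (Fintype.card F : ℝ)⁻¹ := by positivity
  have hx2 : (Fintype.card F : ℝ)⁻¹ ≤ 1 / 2 := by
    rw [one_div]
    exact inv_anti₀ two_pos hq
  have hlow : ((Fintype.card F : ℝ) ^ 2)⁻¹ ≤ detBias F (k + 2) y := by
    rw [detBias_eq (k + 1) hy, ← inv_pow]
    linarith [prod_one_sub_pow_le hx (by linarith) k]
  have hupp : detBias F (k + 2) y < (Fintype.card F : ℝ)⁻¹ := by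
    rw [detBias_eq (k + 1) hy]
    linarith [one_sub_add_pow_le_prod_one_sub_pow hx hx2 (k + 1), pow_pos hx (k + 1 + 1)]
  refine ⟨⟨hlow, hupp⟩, ?_⟩
  have hb : 0 < detBias F (k + 2) y := lt_of_lt_of_le (by positivity) hlow
  have hq1 : 1 < (Fintype.card F : ℝ) := by linarith
  rw [Int.ceil_eq_iff]
  constructor
  · have := Real.logb_lt_logb hq1 hb hupp
    rw [Real.logb_inv, Real.logb_self_eq_one hq1] at this
    norm_num
    linarith
  · have := Real.logb_le_logb_of_le hq1 (by positivity) hlow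
    rw [Real.logb_inv, Real.logb_pow, Real.logb_self_eq_one hq1] at this
    norm_num at this ⊢
    linarith
end
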